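/- arXiv:2501.09189 — 2 statements merged into one kernel-verified Lean document; each statement's English description precedes it below -/
import Mathlib

section
/- There exists an absolute constant C ≥ 1 such that for every dimension d ≥ 2, every ε ∈ (0,1), every integer k₂ ≥ 4, and every unit vector v ∈ ℝ^d, there is a finite partition 𝒞 of ℝ^d each of whose members is of the form {x ∈ ℝ^d : a ≤ v·x < b} with a < b taken from the set {−∞, +∞} ∪ {j·ε : j ∈ ℤ, |j| ≤ k₁}, where k₁ := ⌈2√(log(2/ε))/ε⌉, with the following property: for every unit vector v' ∈ ℝ^d, the function x ↦ 1_{sign(v·x) ≠ sign(v'·x)} has (C·∠(v,v')·(log(k₂+2))⁵/k₂^{1/4} + 10ε, C·d^{10·k₂})-sandwiching degree at most k₂ in L2 norm under N(0,I_d) with respect to 𝒞. -/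
open MeasureTheory ProbabilityTheory Real
open scoped ENNReal

noncomputable section

/-- `sgn t = 1` if `t ≥ 0` and `-1` otherwise. -/
def sgn (t : ℝ) : ℝ := if 0 ≤ t then 1 else -1

/-- Euclidean dot product on `ℝ^d`. -/
def dotp {d : ℕ} (v w : Fin d → ℝ) : ℝ := ∑ i, v i * w i

/-- `v` is a unit vector. -/
def IsUnitVec {d : ℕ} (v : Fin d → ℝ) : Prop := dotp v v = 1

/-- The standard Gaussian measure `N(0, I_d)` on `ℝ^d`. -/
def stdGaussian (d : ℕ) : Measure (Fin d → ℝ) := Measure.pi fun _ => gaussianReal 0 1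

/-- The angle `∠(v, v') = arccos (v ⬝ v')` between unit vectors. -/
def angleOf {d : ℕ} (v w : Fin d → ℝ) : ℝ := Real.arccos (dotp v w)

/-- `f` has `(ν, B)`-sandwiching degree at most `k` in `L2` norm under `N(0, I_d)` with
respect to the partition `𝒞`. -/
def SandwichL2 {d : ℕ} (𝒞 : Finset (Set (Fin d → ℝ))) (f : (Fin d → ℝ) → ℝ)
    (k : ℕ) (ν B : ℝ) : Prop :=
  ∃ pd pu : Set (Fin d → ℝ) → MvPolynomial (Fin d) ℝ,
    (∀ A ∈ 𝒞, (pd A).totalDegree ≤ k ∧ (pu A).totalDegree ≤ k ∧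
      (∀ m, |(pd A).coeff m| ≤ B) ∧ (∀ m, |(pu A).coeff m| ≤ B)) ∧
    (∀ x, (∑ A ∈ 𝒞, Set.indicator A (fun y => MvPolynomial.eval y (pd A)) x) ≤ f x ∧
      f x ≤ ∑ A ∈ 𝒞, Set.indicator A (fun y => MvPolynomial.eval y (pu A)) x) ∧
    (∫ x, (∑ A ∈ 𝒞, Set.indicator A
        (fun y => MvPolynomial.eval y (pu A) - MvPolynomial.eval y (pd A)) x) ^ 2
      ∂(stdGaussian d)) ≤ ν

/-! ### Part A: two-dimensional marginals of the Gaussian -/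

lemma charFunDual_gaussianReal_std (L : StrongDual ℝ ℝ) :
    charFunDual (gaussianReal 0 1) L = Complex.exp (-((L 1 : ℝ) : ℂ) ^ 2 / 2) := by
  rw [charFunDual_eq_charFun_map_one, gaussianReal_map_continuousLinearMap, charFun_gaussianReal]
  simp [neg_div, max_eq_left (sq_nonneg (L 1))]

/-- the linear map `x ↦ (v·x, w·x)`. -/
def pairMap {d : ℕ} (v w : Fin d → ℝ) : (Fin d → ℝ) →L[ℝ] ℝ × ℝ :=
  (∑ i, v i • ContinuousLinearMap.proj i).prod (∑ i, w i • ContinuousLinearMap.proj i)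

lemma pairMap_apply {d : ℕ} (v w x : Fin d → ℝ) : pairMap v w x = (dotp v x, dotp w x) := by
  simp [pairMap, dotp]

instance {d : ℕ} : IsProbabilityMeasure (_root_.stdGaussian d) := by
  unfold _root_.stdGaussian; infer_instance

lemma map_pair {d : ℕ} (v w : Fin d → ℝ) (hv : dotp v v = 1) (hw : dotp w w = 1)
    (hvw : dotp v w = 0) :
    (_root_.stdGaussian d).map (fun x => (dotp v x, dotp w x)) =
      (gaussianReal 0 1).prod (gaussianReal 0 1) := by
  have h0 : (fun x => (dotp v x, dotp w x)) = (pairMap v w : (Fin d → ℝ) → ℝ × ℝ) := by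
    funext x; rw [pairMap_apply]
  rw [h0]
  have : IsProbabilityMeasure ((_root_.stdGaussian d).map (pairMap v w)) :=
    Measure.isProbabilityMeasure_map (by fun_prop)
  apply Measure.ext_of_charFunDual
  ext L
  rw [charFunDual_map, charFunDual_prod, _root_.stdGaussian, charFunDual_pi]
  simp_rw [charFunDual_gaussianReal_std, ← Complex.exp_add, ← Complex.exp_sum]
  congr 1
  have hL : ∀ i, L (pairMap v w (Pi.single i 1)) = L (1, 0) * v i + L (0, 1) * w i := by
    intro i
    rw [pairMap_apply]
    have : (dotp v (Pi.single i 1), dotp w (Pi.single i 1)) =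
        v i • ((1, 0) : ℝ × ℝ) + w i • ((0, 1) : ℝ × ℝ) := by
      simp [dotp, Pi.single_apply]
    rw [this, map_add, map_smul, map_smul]
    simp [mul_comm]
  have h1 : ∀ i, ((L.comp (pairMap v w)).comp (ContinuousLinearMap.single ℝ (fun _ : Fin d => ℝ) i)) 1
      = L (1, 0) * v i + L (0, 1) * w i := by
    intro i; rw [← hL]; rfl
  simp_rw [h1]
  have e1 : (L.comp (ContinuousLinearMap.inl ℝ ℝ ℝ)) 1 = L (1, 0) := rfl
  have e2 : (L.comp (ContinuousLinearMap.inr ℝ ℝ ℝ)) 1 = L (0, 1) := rfl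
  rw [e1, e2]
  have key : ∑ i, (L (1, 0) * v i + L (0, 1) * w i) ^ 2 = L (1, 0) ^ 2 + L (0, 1) ^ 2 := by
    have : ∀ i, (L (1, 0) * v i + L (0, 1) * w i) ^ 2 = L (1, 0) ^ 2 * (v i * v i)
      + 2 * L (1, 0) * L (0, 1) * (v i * w i) + L (0, 1) ^ 2 * (w i * w i) := fun i => by ring
    simp_rw [this, Finset.sum_add_distrib, ← Finset.mul_sum]
    unfold dotp at hv hw hvw
    rw [hv, hw, hvw]; ring
  rw [← Finset.sum_div, Finset.sum_neg_distrib]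
  have key' := congrArg (fun r : ℝ => (r : ℂ)) key
  push_cast at key'
  push_cast
  rw [key']; ring

lemma dotp_comm {d : ℕ} (v w : Fin d → ℝ) : dotp v w = dotp w v := by
  simp [dotp, mul_comm]

lemma dotp_add {d : ℕ} (u v w : Fin d → ℝ) : dotp u (v + w) = dotp u v + dotp u w := by
  simp [dotp, mul_add, Finset.sum_add_distrib]

lemma dotp_smul {d : ℕ} (c : ℝ) (u v : Fin d → ℝ) : dotp u (c • v) = c * dotp u v := by
  simp only [dotp, Finset.mul_sum, Pi.smul_apply, smul_eq_mul]
  exact Finset.sum_congr rfl fun i _ => by ring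

lemma add_dotp {d : ℕ} (u v w : Fin d → ℝ) : dotp (v + w) u = dotp v u + dotp w u := by
  rw [dotp_comm, dotp_add, dotp_comm u, dotp_comm u]

lemma smul_dotp {d : ℕ} (c : ℝ) (u v : Fin d → ℝ) : dotp (c • v) u = c * dotp v u := by
  rw [dotp_comm, dotp_smul, dotp_comm]

lemma dotp_self_nonneg {d : ℕ} (v : Fin d → ℝ) : 0 ≤ dotp v v :=
  Finset.sum_nonneg fun i _ => mul_self_nonneg _

lemma eq_zero_of_dotp {d : ℕ} (v : Fin d → ℝ) (h : dotp v v = 0) : v = 0 := by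
  unfold dotp at h
  rw [Finset.sum_eq_zero_iff_of_nonneg (fun i _ => mul_self_nonneg _)] at h
  funext i
  simpa using h i (Finset.mem_univ i)

lemma exists_normalize {d : ℕ} (v u : Fin d → ℝ) (hu : u ≠ 0) (hvu : dotp v u = 0) :
    ∃ w : Fin d → ℝ, ∃ σ : ℝ, 0 < σ ∧ dotp w w = 1 ∧ dotp v w = 0 ∧ u = σ • w := by
  have hpos : 0 < dotp u u := lt_of_le_of_ne (dotp_self_nonneg u)
    (fun h => hu (eq_zero_of_dotp u h.symm))
  have hs := Real.sqrt_pos.2 hpos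
  refine ⟨(Real.sqrt (dotp u u))⁻¹ • u, Real.sqrt (dotp u u), hs, ?_, ?_, ?_⟩
  · rw [smul_dotp, dotp_smul]
    have := Real.mul_self_sqrt hpos.le
    field_simp
    nlinarith
  · rw [dotp_smul, hvu, mul_zero]
  · rw [smul_smul, mul_inv_cancel₀ hs.ne', one_smul]

lemma exists_orth {d : ℕ} (hd : 2 ≤ d) (v : Fin d → ℝ) (hv : dotp v v = 1) :
    ∃ w : Fin d → ℝ, dotp w w = 1 ∧ dotp v w = 0 := by
  have hne : v ≠ 0 := by
    rintro rfl; simp [dotp] at hv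
  obtain ⟨i, hi⟩ : ∃ i, v i ≠ 0 := by
    by_contra! h; exact hne (funext h)
  have : Nontrivial (Fin d) := Fin.nontrivial_iff_two_le.2 hd
  obtain ⟨j, hj⟩ := exists_ne i
  obtain ⟨w, σ, -, h1, h2, -⟩ := exists_normalize v
    (v i • Pi.single j (1:ℝ) + (-v j) • Pi.single i (1:ℝ))
    (by
      intro h
      have := congrFun h j
      simp [hj] at this
      exact hi this)
    (by
      rw [dotp_add, dotp_smul, dotp_smul]
      simp [dotp, Pi.single_apply]; ring)
  exact ⟨w, h1, h2⟩

lemma exists_decomp {d : ℕ} (hd : 2 ≤ d) (v v' : Fin d → ℝ) (hv : dotp v v = 1)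
    (hv' : dotp v' v' = 1) :
    ∃ w : Fin d → ℝ, ∃ σ : ℝ, 0 ≤ σ ∧ dotp w w = 1 ∧ dotp v w = 0 ∧
      (dotp v v') ^ 2 + σ ^ 2 = 1 ∧ ∀ x, dotp v' x = dotp v v' * dotp v x + σ * dotp w x := by
  have main : ∃ w : Fin d → ℝ, ∃ σ : ℝ, 0 ≤ σ ∧ dotp w w = 1 ∧ dotp v w = 0 ∧
      v' = dotp v v' • v + σ • w := by
    by_cases hu : v' + (-dotp v v') • v = 0
    · obtain ⟨w, h1, h2⟩ := exists_orth hd v hv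
      refine ⟨w, 0, le_rfl, h1, h2, ?_⟩
      rw [zero_smul, add_zero]
      rw [neg_smul, ← sub_eq_add_neg] at hu
      exact sub_eq_zero.1 hu
    · obtain ⟨w, σ, h0, h1, h2, h3⟩ := exists_normalize v _ hu (by
        rw [dotp_add, dotp_smul, hv]; ring)
      refine ⟨w, σ, h0.le, h1, h2, ?_⟩
      rw [← h3, neg_smul]; abel
  obtain ⟨w, σ, h0, h1, h2, h3⟩ := main
  refine ⟨w, σ, h0, h1, h2, ?_, ?_⟩
  · have h4 : dotp v' v' = dotp (dotp v v' • v + σ • w) (dotp v v' • v + σ • w) := by rw [← h3]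
    rw [hv'] at h4
    simp only [add_dotp, dotp_add, smul_dotp, dotp_smul, h1, h2, hv, dotp_comm w v] at h4
    linarith
  · intro x
    conv_lhs => rw [h3]
    rw [add_dotp, smul_dotp, smul_dotp]

/-! ### Part B: coefficient norms -/

/-- sum of absolute values of the coefficients. -/
def l1 (p : Polynomial ℝ) : ℝ := ∑ i ∈ p.support, |p.coeff i|

lemma l1_eq (p : Polynomial ℝ) (s : Finset ℕ) (h : p.support ⊆ s) : l1 p = ∑ i ∈ s, |p.coeff i| := by
  unfold l1
  apply Finset.sum_subset h
  intro i _ hi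
  simpa using hi

lemma l1_nonneg (p : Polynomial ℝ) : 0 ≤ l1 p := Finset.sum_nonneg fun _ _ => abs_nonneg _

lemma l1_add (p q : Polynomial ℝ) : l1 (p + q) ≤ l1 p + l1 q := by
  classical
  rw [l1_eq (p + q) (p.support ∪ q.support) Polynomial.support_add,
    l1_eq p (p.support ∪ q.support) Finset.subset_union_left,
    l1_eq q (p.support ∪ q.support) Finset.subset_union_right, ← Finset.sum_add_distrib]
  apply Finset.sum_le_sum
  intro i _
  rw [Polynomial.coeff_add]
  exact abs_add_le _ _

lemma l1_zero : l1 0 = 0 := by simp [l1]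

lemma l1_sum {ι : Type*} (s : Finset ι) (f : ι → Polynomial ℝ) :
    l1 (∑ i ∈ s, f i) ≤ ∑ i ∈ s, l1 (f i) := by
  classical
  induction s using Finset.induction_on with
  | empty => simp [l1_zero]
  | insert a s ha ih =>
    rw [Finset.sum_insert ha, Finset.sum_insert ha]
    exact (l1_add _ _).trans (by linarith)

lemma l1_monomial (n : ℕ) (c : ℝ) : l1 (Polynomial.monomial n c) = |c| := by
  rw [l1_eq _ {n} (Polynomial.support_monomial' n c)]
  simp

lemma l1_neg (p : Polynomial ℝ) : l1 (-p) = l1 p := by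
  simp [l1]

lemma l1_sub (p q : Polynomial ℝ) : l1 (p - q) ≤ l1 p + l1 q := by
  rw [sub_eq_add_neg]
  exact (l1_add _ _).trans (by rw [l1_neg])

lemma l1_C (c : ℝ) : l1 (Polynomial.C c) = |c| := by
  rw [← Polynomial.monomial_zero_left, l1_monomial]

lemma l1_one : l1 1 = 1 := by
  rw [← Polynomial.C_1, l1_C]; simp

lemma l1_X : l1 Polynomial.X = 1 := by
  rw [← Polynomial.monomial_one_one_eq_X, l1_monomial]; simp

lemma l1_mul (p q : Polynomial ℝ) : l1 (p * q) ≤ l1 p * l1 q := by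
  have hp := p.as_sum_support
  have hq := q.as_sum_support
  conv_lhs => rw [hp, hq]
  rw [Finset.sum_mul_sum]
  refine (l1_sum _ _).trans ?_
  unfold l1
  rw [Finset.sum_mul_sum]
  apply Finset.sum_le_sum
  intro i _
  refine (l1_sum _ _).trans ?_
  apply Finset.sum_le_sum
  intro j _
  rw [Polynomial.monomial_mul_monomial, l1_monomial, abs_mul]

lemma l1_pow (p : Polynomial ℝ) (n : ℕ) : l1 (p ^ n) ≤ l1 p ^ n := by
  induction n with
  | zero => simp [l1_one]
  | succ n ih =>
    rw [pow_succ, pow_succ]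
    exact (l1_mul _ _).trans (mul_le_mul_of_nonneg_right ih (l1_nonneg _))

lemma l1_comp (p q : Polynomial ℝ) (hq : l1 q ≤ 1) : l1 (p.comp q) ≤ l1 p := by
  rw [Polynomial.comp_eq_sum_left, Polynomial.sum]
  refine (l1_sum _ _).trans ?_
  apply Finset.sum_le_sum
  intro i _
  refine (l1_mul _ _).trans ?_
  rw [l1_C]
  have : l1 (q ^ i) ≤ 1 := (l1_pow q i).trans (pow_le_one₀ (l1_nonneg _) hq)
  nlinarith [abs_nonneg (p.coeff i)]

lemma abs_eval_le (p : Polynomial ℝ) (n : ℕ) (hn : p.natDegree ≤ n) (x : ℝ) (hx : 1 ≤ |x|) :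
    |p.eval x| ≤ l1 p * |x| ^ n := by
  rw [Polynomial.eval_eq_sum, Polynomial.sum, l1, Finset.sum_mul]
  refine (Finset.abs_sum_le_sum_abs _ _).trans (Finset.sum_le_sum fun i hi => ?_)
  rw [abs_mul, abs_pow]
  exact mul_le_mul_of_nonneg_left
    (pow_le_pow_right₀ hx ((Polynomial.le_natDegree_of_mem_supp i hi).trans hn)) (abs_nonneg _)

/-- multivariate version. -/
def l1m {d : ℕ} (p : MvPolynomial (Fin d) ℝ) : ℝ := ∑ i ∈ p.support, |p.coeff i|

section mv
variable {d : ℕ}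

lemma l1m_eq (p : MvPolynomial (Fin d) ℝ) (s : Finset (Fin d →₀ ℕ)) (h : p.support ⊆ s) :
    l1m p = ∑ i ∈ s, |p.coeff i| := by
  unfold l1m
  apply Finset.sum_subset h
  intro i _ hi
  simpa using hi

lemma l1m_nonneg (p : MvPolynomial (Fin d) ℝ) : 0 ≤ l1m p :=
  Finset.sum_nonneg fun _ _ => abs_nonneg _

lemma abs_coeff_le_l1m (p : MvPolynomial (Fin d) ℝ) (m : Fin d →₀ ℕ) : |p.coeff m| ≤ l1m p := by
  classical
  rw [l1m_eq p (insert m p.support) (Finset.subset_insert _ _)]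
  exact Finset.single_le_sum (f := fun i => |p.coeff i|) (fun _ _ => abs_nonneg _)
    (Finset.mem_insert_self _ _)

lemma l1m_add (p q : MvPolynomial (Fin d) ℝ) : l1m (p + q) ≤ l1m p + l1m q := by
  classical
  rw [l1m_eq (p + q) (p.support ∪ q.support) MvPolynomial.support_add,
    l1m_eq p (p.support ∪ q.support) Finset.subset_union_left,
    l1m_eq q (p.support ∪ q.support) Finset.subset_union_right, ← Finset.sum_add_distrib]
  apply Finset.sum_le_sum
  intro i _
  rw [MvPolynomial.coeff_add]
  exact abs_add_le _ _

lemma l1m_zero : l1m (0 : MvPolynomial (Fin d) ℝ) = 0 := by simp [l1m]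

lemma l1m_sum {ι : Type*} (s : Finset ι) (f : ι → MvPolynomial (Fin d) ℝ) :
    l1m (∑ i ∈ s, f i) ≤ ∑ i ∈ s, l1m (f i) := by
  classical
  induction s using Finset.induction_on with
  | empty => simp [l1m_zero]
  | insert a s ha ih =>
    rw [Finset.sum_insert ha, Finset.sum_insert ha]
    exact (l1m_add _ _).trans (by linarith)

lemma l1m_monomial (n : Fin d →₀ ℕ) (c : ℝ) : l1m (MvPolynomial.monomial n c) = |c| := by
  rw [l1m_eq _ {n} MvPolynomial.support_monomial_subset]
  simp

lemma l1m_mul (p q : MvPolynomial (Fin d) ℝ) : l1m (p * q) ≤ l1m p * l1m q := by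
  have hp := p.support_sum_monomial_coeff
  have hq := q.support_sum_monomial_coeff
  conv_lhs => rw [← hp, ← hq]
  rw [Finset.sum_mul_sum]
  refine (l1m_sum _ _).trans ?_
  unfold l1m
  rw [Finset.sum_mul_sum]
  apply Finset.sum_le_sum
  intro i _
  refine (l1m_sum _ _).trans ?_
  apply Finset.sum_le_sum
  intro j _
  rw [MvPolynomial.monomial_mul]
  exact (l1m_monomial _ _).le.trans (abs_mul _ _).le

lemma l1m_pow (p : MvPolynomial (Fin d) ℝ) (n : ℕ) : l1m (p ^ n) ≤ l1m p ^ n := by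
  induction n with
  | zero =>
    rw [pow_zero, pow_zero]
    have := l1m_monomial (0 : Fin d →₀ ℕ) 1
    simp at this
    exact this.le
  | succ n ih =>
    rw [pow_succ, pow_succ]
    exact (l1m_mul _ _).trans (mul_le_mul_of_nonneg_right ih (l1m_nonneg _))

/-- the linear form as a polynomial. -/
def linForm (w : Fin d → ℝ) : MvPolynomial (Fin d) ℝ :=
  ∑ i, MvPolynomial.monomial (Finsupp.single i 1) (w i)

lemma eval_linForm (w x : Fin d → ℝ) : MvPolynomial.eval x (linForm w) = dotp w x := by
  simp [linForm, dotp, MvPolynomial.eval_monomial]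

lemma l1m_linForm (w : Fin d → ℝ) (hw : dotp w w = 1) : l1m (linForm w) ≤ d := by
  refine (l1m_sum _ _).trans ?_
  simp_rw [l1m_monomial]
  have : ∀ i ∈ Finset.univ, |w i| ≤ 1 := by
    intro i _
    rw [← sq_le_one_iff_abs_le_one, sq, ← hw]
    exact Finset.single_le_sum (f := fun i => w i * w i) (fun _ _ => mul_self_nonneg _)
      (Finset.mem_univ i)
  simpa using Finset.sum_le_sum this

lemma totalDegree_linForm (w : Fin d → ℝ) : (linForm w).totalDegree ≤ 1 := by
  refine (MvPolynomial.totalDegree_finset_sum _ _).trans ?_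
  apply Finset.sup_le
  intro i _
  refine (MvPolynomial.totalDegree_monomial_le _ _).trans ?_
  simp

/-- `q(w·x)` as a polynomial. -/
def lift (w : Fin d → ℝ) (q : Polynomial ℝ) : MvPolynomial (Fin d) ℝ :=
  Polynomial.aeval (linForm w) q

lemma eval_lift (w x : Fin d → ℝ) (q : Polynomial ℝ) :
    MvPolynomial.eval x (lift w q) = q.eval (dotp w x) := by
  unfold lift
  rw [Polynomial.aeval_eq_sum_range, map_sum, Polynomial.eval_eq_sum_range]
  simp [eval_linForm, MvPolynomial.smul_eval]

lemma lift_bounds (hd : 2 ≤ d) (w : Fin d → ℝ) (hw : dotp w w = 1) (q : Polynomial ℝ) (k : ℕ)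
    (hk : q.natDegree ≤ k) :
    (lift w q).totalDegree ≤ k ∧ ∀ m, |(lift w q).coeff m| ≤ l1 q * (d:ℝ) ^ k := by
  have hd1 : (1:ℝ) ≤ d := by exact_mod_cast (by omega : 1 ≤ d)
  constructor
  · unfold lift
    rw [Polynomial.aeval_eq_sum_range]
    refine (MvPolynomial.totalDegree_finset_sum _ _).trans (Finset.sup_le fun i hi => ?_)
    refine (MvPolynomial.totalDegree_smul_le _ _).trans ?_
    refine (MvPolynomial.totalDegree_pow _ _).trans ?_
    have := totalDegree_linForm w
    simp at hi
    nlinarith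
  · intro m
    refine (abs_coeff_le_l1m _ _).trans ?_
    unfold lift
    rw [Polynomial.aeval_eq_sum_range' (n := q.natDegree + 1) (by omega)]
    refine (l1m_sum _ _).trans ?_
    rw [l1_eq q (Finset.range (q.natDegree + 1)) Polynomial.supp_subset_range_natDegree_succ,
      Finset.sum_mul]
    apply Finset.sum_le_sum
    intro i hi
    simp at hi
    rw [MvPolynomial.smul_eq_C_mul]
    refine (l1m_mul _ _).trans ?_
    have h1 : l1m (MvPolynomial.C (q.coeff i) : MvPolynomial (Fin d) ℝ) = |q.coeff i| :=
      l1m_monomial 0 _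
    rw [h1]
    apply mul_le_mul_of_nonneg_left _ (abs_nonneg _)
    calc l1m (linForm w ^ i) ≤ l1m (linForm w) ^ i := l1m_pow _ _
      _ ≤ (d:ℝ) ^ i := pow_le_pow_left₀ (l1m_nonneg _) (l1m_linForm w hw) _
      _ ≤ (d:ℝ) ^ k := pow_le_pow_right₀ hd1 (by omega)

end mv

/-! ### Part C: the kernel -/

section kernel
open Polynomial

lemma T_bounds (n : ℕ) : (Chebyshev.T ℝ (n:ℤ)).natDegree ≤ n ∧ l1 (Chebyshev.T ℝ (n:ℤ)) ≤ 3 ^ n := by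
  induction n using Nat.twoStepInduction with
  | zero => simp [l1_one]
  | one => simp [l1_X]
  | more n ih1 ih2 =>
    have e : Chebyshev.T ℝ ((n + 2 : ℕ):ℤ) = (C 2 * X) * Chebyshev.T ℝ ((n + 1 : ℕ):ℤ)
        - Chebyshev.T ℝ (n:ℤ) := by
      push_cast
      rw [Chebyshev.T_add_two]
      have h2 : (C (2:ℝ) : ℝ[X]) = 2 := map_ofNat C 2
      rw [h2]
    have h2 : l1 (C (2:ℝ) * X) ≤ 2 := by
      refine (l1_mul _ _).trans ?_
      rw [l1_C, l1_X]; norm_num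
    constructor
    · rw [e]
      refine (natDegree_sub_le _ _).trans ?_
      have h3 : (C (2:ℝ) * X).natDegree ≤ 1 := by
        refine (natDegree_C_mul_le _ _).trans natDegree_X_le
      have h4 := natDegree_mul_le (p := C (2:ℝ) * X) (q := Chebyshev.T ℝ ((n + 1 : ℕ):ℤ))
      have h5 := ih1.1
      have h6 := ih2.1
      apply max_le <;> omega
    · rw [e]
      refine (l1_sub _ _).trans ?_
      have h3 := l1_mul (C (2:ℝ) * X) (Chebyshev.T ℝ ((n + 1 : ℕ):ℤ))
      have h4 := ih1.2
      have h5 := ih2.2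
      have h6 := l1_nonneg (Chebyshev.T ℝ ((n + 1 : ℕ):ℤ))
      have h7 : (0:ℝ) < 3 ^ n := by positivity
      rw [pow_succ] at h5 ⊢
      rw [pow_succ]
      nlinarith

/-- antiderivative vanishing at zero. -/
def antider (p : ℝ[X]) : ℝ[X] := ∑ i ∈ p.support, monomial (i + 1) (p.coeff i / (i + 1))

lemma derivative_antider (p : ℝ[X]) : derivative (antider p) = p := by
  unfold antider
  rw [derivative_sum]
  conv_rhs => rw [p.as_sum_support]
  apply Finset.sum_congr rfl
  intro i _
  rw [derivative_monomial]
  simp only [Nat.add_sub_cancel]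
  congr 1
  push_cast
  field_simp

lemma eval_antider_zero (p : ℝ[X]) : (antider p).eval 0 = 0 := by
  unfold antider
  rw [eval_finsetSum]
  simp

lemma l1_antider (p : ℝ[X]) : l1 (antider p) ≤ l1 p := by
  unfold antider
  refine (l1_sum _ _).trans ?_
  rw [l1]
  apply Finset.sum_le_sum
  intro i _
  rw [l1_monomial, abs_div]
  apply div_le_self (abs_nonneg _)
  rw [abs_of_nonneg (by positivity)]
  linarith [(Nat.cast_nonneg i : (0:ℝ) ≤ i)]

lemma natDegree_antider (p : ℝ[X]) : (antider p).natDegree ≤ p.natDegree + 1 := by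
  unfold antider
  apply natDegree_sum_le_of_forall_le
  intro i hi
  refine (natDegree_monomial_le _).trans ?_
  have := le_natDegree_of_mem_supp i hi
  omega

lemma T_odd_zero (l : ℕ) : (Chebyshev.T ℝ ((2 * l + 1 : ℕ):ℤ)).coeff 0 = 0 := by
  rw [coeff_zero_eq_eval_zero]
  apply Chebyshev.T_eval_zero_of_odd
  exact ⟨l, by push_cast; ring⟩

/-- `T_{2l+1}(x)/x`. -/
def Dk (l : ℕ) : ℝ[X] := (Chebyshev.T ℝ ((2 * l + 1 : ℕ):ℤ)).divX

lemma X_mul_Dk (l : ℕ) : X * Dk l = Chebyshev.T ℝ ((2 * l + 1 : ℕ):ℤ) := by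
  have := X_mul_divX_add (Chebyshev.T ℝ ((2 * l + 1 : ℕ):ℤ))
  rw [T_odd_zero] at this
  simpa [Dk] using this

lemma Dk_eval (l : ℕ) (x : ℝ) :
    x * (Dk l).eval x = (Chebyshev.T ℝ ((2 * l + 1 : ℕ):ℤ)).eval x := by
  rw [← X_mul_Dk]; simp

lemma l1_Dk (l : ℕ) : l1 (Dk l) ≤ 3 ^ (2 * l + 1) := by
  refine le_trans ?_ (T_bounds (2 * l + 1)).2
  set T := Chebyshev.T ℝ ((2 * l + 1 : ℕ):ℤ) with hT
  have h1 : (Dk l).support ⊆ Finset.range (T.natDegree + 1) := by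
    intro i hi
    rw [mem_support_iff, Dk, coeff_divX, ← hT] at hi
    have := le_natDegree_of_ne_zero hi
    simp; omega
  rw [l1_eq _ _ h1, l1_eq T (Finset.range (T.natDegree + 1 + 1)) (by
    intro i hi
    have := le_natDegree_of_mem_supp i hi
    simp; omega), Finset.sum_range_succ' (fun i => |T.coeff i|) (T.natDegree + 1)]
  have : ∀ i, (Dk l).coeff i = T.coeff (i + 1) := fun i => by rw [Dk, coeff_divX]
  simp_rw [this]
  linarith [abs_nonneg (T.coeff 0)]

lemma natDegree_Dk (l : ℕ) : (Dk l).natDegree ≤ 2 * l := by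
  rw [Dk, natDegree_divX_eq_natDegree_tsub_one]
  have := (T_bounds (2 * l + 1)).1
  omega

lemma Dk_even (l : ℕ) (x : ℝ) : (Dk l).eval (-x) = (Dk l).eval x := by
  by_cases hx : x = 0
  · simp [hx]
  have h1 := Dk_eval l x
  have h2 := Dk_eval l (-x)
  have h4 : ((2 * l + 1 : ℕ):ℤ).negOnePow = -1 := Int.negOnePow_odd _ ⟨l, by push_cast; ring⟩
  rw [Chebyshev.T_eval_neg, h4] at h2
  apply mul_left_cancel₀ hx
  rw [h1]
  simp at h2
  push_cast at *
  linarith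

/-- The primitive of the Fejer type kernel. -/
def Ak (l : ℕ) : ℝ[X] := antider (Dk l ^ 2)

lemma Ak_hasDeriv (l : ℕ) (x : ℝ) :
    HasDerivAt (fun u => (Ak l).eval u) ((Dk l).eval x ^ 2) x := by
  have h : derivative (Ak l) = Dk l ^ 2 := derivative_antider _
  have := (Ak l).hasDerivAt x
  rw [h, eval_pow] at this
  exact this

lemma Ak_mono (l : ℕ) : Monotone (fun u => (Ak l).eval u) :=
  monotone_of_hasDerivAt_nonneg (fun x => Ak_hasDeriv l x) (fun x => sq_nonneg _)

lemma Ak_zero (l : ℕ) : (Ak l).eval 0 = 0 := eval_antider_zero _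

lemma Ak_odd (l : ℕ) (x : ℝ) : (Ak l).eval (-x) = -(Ak l).eval x := by
  have h : ∀ y, HasDerivAt (fun u => (Ak l).eval (-u) + (Ak l).eval u) 0 y := by
    intro y
    have h1 : HasDerivAt (fun u => (Ak l).eval (-u)) ((Dk l).eval (-y) ^ 2 * (-1)) y :=
      HasDerivAt.comp y (h₂ := fun u => (Ak l).eval u) (Ak_hasDeriv l (-y)) (hasDerivAt_neg y)
    have h2 := h1.add (Ak_hasDeriv l y)
    rw [Dk_even] at h2
    have e : eval y (Dk l) ^ 2 * -1 + eval y (Dk l) ^ 2 = 0 := by ring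
    rw [e] at h2
    exact h2
  have := is_const_of_deriv_eq_zero (fun y => (h y).differentiableAt) (fun y => (h y).deriv) x 0
  simp only [neg_zero, Ak_zero] at this
  linarith

lemma l1_Ak (l : ℕ) : l1 (Ak l) ≤ 9 ^ (2 * l + 1) := by
  refine (l1_antider _).trans ((l1_pow _ _).trans ?_)
  calc l1 (Dk l) ^ 2 ≤ (3 ^ (2 * l + 1)) ^ 2 := pow_le_pow_left₀ (l1_nonneg _) (l1_Dk l) 2
    _ = 9 ^ (2 * l + 1) := by rw [← pow_mul, mul_comm, pow_mul]; norm_num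

lemma natDegree_Ak (l : ℕ) : (Ak l).natDegree ≤ 4 * l + 1 := by
  refine (natDegree_antider _).trans ?_
  have h1 := natDegree_pow_le (p := Dk l) (n := 2)
  have h2 := natDegree_Dk l
  omega

lemma Dk_lower (l : ℕ) (x : ℝ) (hx : 0 < x) (hx1 : x * (2 * l + 1) ≤ 1) :
    (2 * l + 1 : ℝ) ^ 2 / 3 ≤ (Dk l).eval x ^ 2 := by
  have hl : (0:ℝ) ≤ l := Nat.cast_nonneg l
  have hx2 : x ≤ 1 := by nlinarith
  set φ := arcsin x with hφ
  have hs : sin φ = x := Real.sin_arcsin (by linarith) hx2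
  have hφ0 : 0 < φ := Real.arcsin_pos.2 hx
  have hφ1 : φ ≤ π / 2 := Real.arcsin_le_pi_div_two x
  have h1 : 2 / π * φ ≤ x := by rw [← hs]; exact Real.mul_le_sin hφ0.le hφ1
  have hpi := Real.pi_pos
  have hmφ : (2 * l + 1) * φ ≤ π / 2 := by
    have : φ ≤ π / 2 * x := by
      calc φ = π / 2 * (2 / π * φ) := by field_simp
        _ ≤ π / 2 * x := by gcongr
    nlinarith
  have hxφ : x ≤ φ := by rw [← hs]; exact Real.sin_le hφ0.le
  have h2 : 2 / π * ((2 * l + 1) * φ) ≤ sin ((2 * l + 1) * φ) :=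
    Real.mul_le_sin (by positivity) hmφ
  have h3 : (Chebyshev.T ℝ ((2 * l + 1 : ℕ):ℤ)).eval x ^ 2 = sin ((2 * l + 1) * φ) ^ 2 := by
    have : x = cos (π / 2 - φ) := by rw [Real.cos_pi_div_two_sub, hs]
    conv_lhs => rw [this]
    rw [Chebyshev.T_real_cos]
    push_cast
    have : (2 * (l:ℝ) + 1) * (π / 2 - φ) = (π / 2 - (2 * l + 1) * φ) + l * π := by ring
    rw [this, Real.cos_add_nat_mul_pi, Real.cos_pi_div_two_sub, mul_pow, ← pow_mul, mul_comm l 2,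
      pow_mul]
    norm_num
  rw [← Dk_eval, mul_pow] at h3
  have h4 : (2 / π * ((2 * l + 1) * x)) ^ 2 ≤ x ^ 2 * eval x (Dk l) ^ 2 := by
    rw [h3]
    apply pow_le_pow_left₀ (by positivity)
    refine le_trans ?_ h2
    gcongr
  have h5 : (2 / π) ^ 2 * (2 * l + 1) ^ 2 ≤ eval x (Dk l) ^ 2 := by
    have : (2 / π * ((2 * l + 1) * x)) ^ 2 = x ^ 2 * ((2 / π) ^ 2 * (2 * l + 1) ^ 2) := by ring
    rw [this] at h4
    exact le_of_mul_le_mul_left h4 (by positivity)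
  refine le_trans ?_ h5
  have h6 : (1:ℝ) / 3 ≤ (2 / π) ^ 2 := by
    rw [div_pow, div_le_div_iff₀ (by norm_num) (by positivity)]
    nlinarith [Real.pi_lt_d2]
  nlinarith [sq_nonneg (2 * (l:ℝ) + 1)]

lemma Ak_lower (l : ℕ) (ρ : ℝ) (hρ : 1 ≤ ρ * (2 * l + 1)) : (2 * l + 1 : ℝ) / 3 ≤ (Ak l).eval ρ := by
  have hl : (0:ℝ) < 2 * l + 1 := by positivity
  have h1 : 1 / (2 * (l:ℝ) + 1) ≤ ρ := by rwa [div_le_iff₀ hl]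
  refine le_trans ?_ (Ak_mono l h1)
  have := Convex.mul_sub_le_image_sub_of_le_deriv (convex_Icc (0:ℝ) (1 / (2 * (l:ℝ) + 1)))
    (f := fun u => (Ak l).eval u) (by fun_prop) (by fun_prop) (C := (2 * l + 1 : ℝ) ^ 2 / 3) (by
      intro x hx
      rw [interior_Icc] at hx
      rw [(Ak_hasDeriv l x).deriv]
      refine Dk_lower l x hx.1 ?_
      have := hx.2
      rw [lt_div_iff₀ hl] at this
      exact this.le) 0 ⟨le_rfl, by positivity⟩ (1 / (2 * (l:ℝ) + 1)) ⟨by positivity, le_rfl⟩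
      (by positivity)
  simp only [Ak_zero, sub_zero] at this
  refine le_trans (le_of_eq ?_) this
  field_simp

lemma Ak_mid (l : ℕ) (ρ u : ℝ) (hρ : 0 < ρ) (hu : ρ ≤ u) (hu1 : u ≤ 1) :
    (Ak l).eval u - (Ak l).eval ρ ≤ 1 / ρ := by
  have hd : ∀ x ∈ Set.Icc ρ 1, HasDerivAt (fun u => (Ak l).eval u + u⁻¹)
      ((Dk l).eval x ^ 2 + -(x ^ 2)⁻¹) x := by
    intro x hx
    exact (Ak_hasDeriv l x).add (hasDerivAt_inv (by linarith [hx.1]))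
  have h : AntitoneOn (fun u => (Ak l).eval u + u⁻¹) (Set.Icc ρ 1) := by
    apply antitoneOn_of_deriv_nonpos (convex_Icc _ _)
    · intro x hx
      exact (hd x hx).continuousAt.continuousWithinAt
    · intro x hx
      rw [interior_Icc] at hx
      exact (hd x ⟨hx.1.le, hx.2.le⟩).differentiableAt.differentiableWithinAt
    · intro x hx
      rw [interior_Icc] at hx
      rw [(hd x ⟨hx.1.le, hx.2.le⟩).deriv]
      have hx0 : 0 < x := by linarith [hx.1]
      have h1 := Chebyshev.abs_eval_T_real_le_one ((2 * l + 1 : ℕ):ℤ) (x := x)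
        (by rw [abs_of_pos hx0]; exact hx.2.le)
      rw [← Dk_eval, ← sq_le_one_iff_abs_le_one, mul_pow] at h1
      have : eval x (Dk l) ^ 2 ≤ (x ^ 2)⁻¹ := by
        rw [← one_div, le_div_iff₀ (by positivity)]; linarith
      linarith
  have := h ⟨le_rfl, hu.trans hu1⟩ ⟨hu, hu1⟩ hu
  simp only at this
  have h2 : 0 < u⁻¹ := inv_pos.2 (by linarith)
  rw [one_div]; linarith

lemma Ak_far (l : ℕ) (u : ℝ) (hu : 1 ≤ u) :
    (Ak l).eval u - (Ak l).eval 1 ≤ (3 * u) ^ (4 * l + 3) := by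
  have := Convex.image_sub_le_mul_sub_of_deriv_le (convex_Icc (1:ℝ) u)
    (f := fun u => (Ak l).eval u) (by fun_prop) (by fun_prop) (C := (3 * u) ^ (4 * l + 2)) (by
      intro x hx
      rw [interior_Icc] at hx
      rw [(Ak_hasDeriv l x).deriv]
      have hx0 : 0 < x := by linarith [hx.1]
      have h1 := abs_eval_le _ _ (T_bounds (2 * l + 1)).1 x (by rw [abs_of_pos hx0]; exact hx.1.le)
      rw [← Dk_eval, abs_mul, abs_of_pos hx0] at h1
      have h2 : |eval x (Dk l)| ≤ (3 * u) ^ (2 * l + 1) := by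
        calc |eval x (Dk l)| ≤ x * |eval x (Dk l)| := by
              nlinarith [abs_nonneg (eval x (Dk l)), hx.1]
          _ ≤ _ := h1
          _ ≤ 3 ^ (2 * l + 1) * x ^ (2 * l + 1) := by
              gcongr; exact (T_bounds (2 * l + 1)).2
          _ = (3 * x) ^ (2 * l + 1) := by rw [mul_pow]
          _ ≤ _ := by gcongr; exact hx.2.le
      calc eval x (Dk l) ^ 2 = |eval x (Dk l)| ^ 2 := (sq_abs _).symm
        _ ≤ ((3 * u) ^ (2 * l + 1)) ^ 2 := by gcongr
        _ = _ := by rw [← pow_mul]; congr 1; ring) 1 ⟨le_rfl, hu⟩ u ⟨hu, le_rfl⟩ hu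
  refine this.trans ?_
  rw [pow_succ (3 * u) (4 * l + 2)]
  gcongr
  linarith

end kernel

/-! ### Part D: one dimensional Gaussian facts -/

section gauss
open Polynomial

/-- standard Gaussian on the line. -/
abbrev gam : Measure ℝ := gaussianReal 0 1

lemma gint_pow (n : ℕ) : Integrable (fun x : ℝ => x ^ n) gam := by
  by_cases hn : n = 0
  · subst hn; simp
  have h := memLp_id_gaussianReal' (μ := 0) (v := 1) (n : ℝ≥0∞) (by simp)
  have h2 := h.integrable_norm_pow hn
  refine h2.mono (by fun_prop) ?_
  filter_upwards with x
  simp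

lemma gint_poly (p : ℝ[X]) : Integrable (fun x : ℝ => p.eval x) gam := by
  simp_rw [eval_eq_sum_range]
  apply integrable_finsetSum
  intro i _
  exact (gint_pow i).const_mul _

lemma gint_exp (s : ℝ) : Integrable (fun x : ℝ => rexp (s * x)) gam :=
  integrable_exp_mul_gaussianReal s

lemma gexp (s : ℝ) : ∫ x, rexp (s * x) ∂gam = rexp (s ^ 2 / 2) := by
  have := congrFun (mgf_fun_id_gaussianReal (μ := 0) (v := 1)) s
  rw [mgf] at this
  simpa using this

lemma gmom (n : ℕ) (hn : 0 < n) : ∫ x, x ^ (2 * n) ∂gam ≤ 2 * (6 * (n:ℝ)) ^ n := by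
  have hn' : (0:ℝ) < n := by exact_mod_cast hn
  set s : ℝ := √(2 * n) with hs
  have hs2 : s ^ 2 = 2 * n := Real.sq_sqrt (by positivity)
  have hs0 : 0 < s := Real.sqrt_pos.2 (by positivity)
  have hK : (((2 * n).factorial : ℝ)) / s ^ (2 * n) ≤ (2 * n) ^ n := by
    rw [pow_mul, hs2, div_le_iff₀ (by positivity), ← mul_pow, ← sq, ← pow_mul]
    have := Nat.factorial_le_pow (2 * n)
    calc ((2 * n).factorial : ℝ) ≤ ((2 * n) ^ (2 * n) : ℕ) := by exact_mod_cast this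
      _ = _ := by push_cast; ring
  have hpt : ∀ x : ℝ, x ^ (2 * n) ≤ (2 * n) ^ n * (rexp (s * x) + rexp ((-s) * x)) := by
    intro x
    have h1 := Real.pow_div_factorial_le_exp |s * x| (abs_nonneg _) (2 * n)
    have h2 := Real.exp_abs_le (s * x)
    rw [div_le_iff₀ (by positivity)] at h1
    have h3 : |s * x| ^ (2 * n) = s ^ (2 * n) * x ^ (2 * n) := by
      rw [pow_mul, sq_abs, ← pow_mul, mul_pow]
    rw [h3] at h1
    calc x ^ (2 * n) ≤ rexp |s * x| * (((2 * n).factorial : ℝ) / s ^ (2 * n)) := by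
          rw [mul_div_assoc', le_div_iff₀ (by positivity)]; linarith
      _ ≤ (rexp (s * x) + rexp (-(s * x))) * (2 * n) ^ n := by gcongr
      _ = _ := by rw [neg_mul]; ring
  have hi : Integrable (fun x : ℝ => (2 * (n:ℝ)) ^ n * (rexp (s * x) + rexp ((-s) * x))) gam :=
    ((gint_exp s).add (gint_exp (-s))).const_mul _
  refine (integral_mono (gint_pow _) hi hpt).trans ?_
  rw [integral_const_mul, integral_add (gint_exp s) (gint_exp (-s)), gexp, gexp, neg_sq, hs2]
  have h4 : rexp (2 * n / 2) ≤ 3 ^ n := by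
    have : (2 * (n:ℝ) / 2) = n * 1 := by ring
    rw [this, Real.exp_nat_mul]
    gcongr
    exact Real.exp_one_lt_d9.le.trans (by norm_num)
  calc (2 * (n:ℝ)) ^ n * (rexp (2 * n / 2) + rexp (2 * n / 2))
      ≤ (2 * (n:ℝ)) ^ n * (3 ^ n + 3 ^ n) := by gcongr
    _ = 2 * (6 * (n:ℝ)) ^ n := by
      have : (6 * (n:ℝ)) = (2 * n) * 3 := by ring
      rw [this, mul_pow (2 * (n:ℝ)) 3]; ring

lemma gdens (a b : ℝ) (hab : a ≤ b) : gam.real (Set.Icc a b) ≤ (b - a) / 2 := by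
  have h : ∀ x, gaussianPDFReal 0 1 x ≤ 1 / 2 := by
    intro x
    rw [gaussianPDFReal]
    have h1 : (2:ℝ) ≤ √(2 * π * (1 : NNReal)) := by
      apply Real.le_sqrt_of_sq_le
      push_cast
      nlinarith [Real.pi_gt_three]
    have h2 : rexp (-(x - 0) ^ 2 / (2 * (1 : NNReal))) ≤ 1 := by
      rw [Real.exp_le_one_iff]
      push_cast
      nlinarith [sq_nonneg (x - 0)]
    have h3 : (√(2 * π * (1 : NNReal)))⁻¹ ≤ 1 / 2 := by
      rw [one_div]; exact inv_anti₀ (by norm_num) h1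
    calc _ ≤ (1/2 : ℝ) * 1 := by gcongr
      _ = _ := by norm_num
  have h0 : gam (Set.Icc a b) = ENNReal.ofReal (∫ x in Set.Icc a b, gaussianPDFReal 0 1 x) :=
    gaussianReal_apply_eq_integral 0 (by simp) _
  rw [measureReal_def, h0, ENNReal.toReal_ofReal (integral_nonneg fun x => gaussianPDFReal_nonneg _ _ _)]
  have h1 : ∫ x in Set.Icc a b, gaussianPDFReal 0 1 x ≤ ∫ x in Set.Icc a b, (1/2 : ℝ) := by
    apply integral_mono ((integrable_gaussianPDFReal 0 1).restrict)
      (integrable_const _) h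
  refine h1.trans (le_of_eq ?_)
  rw [setIntegral_const]
  simp [measureReal_def, hab]
  ring

lemma gtail1 (a : ℝ) (ha : 0 ≤ a) : gam.real {x | a ≤ x} ≤ rexp (-(a ^ 2) / 2) := by
  have := measure_ge_le_exp_mul_mgf (μ := gam) (X := fun x => x) a ha (gint_exp a)
  refine this.trans (le_of_eq ?_)
  rw [mgf, gexp, ← Real.exp_add]
  congr 1; ring

lemma gtail2 (a : ℝ) (ha : 0 ≤ a) : gam.real {x | x ≤ -a} ≤ rexp (-(a ^ 2) / 2) := by
  have := measure_le_le_exp_mul_mgf (μ := gam) (X := fun x => x) (t := -a) (-a) (by linarith) (gint_exp (-a))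
  refine this.trans (le_of_eq ?_)
  rw [mgf, gexp, ← Real.exp_add]
  congr 1; ring

end gauss

/-! ### Part F: one dimensional sandwich -/

section onedim
open Polynomial

lemma P_bound (l : ℕ) (a u : ℝ) (ha : 2 ≤ a) (hl : a ^ 6 = 2 * l + 1) (hu : 1 / a ^ 5 ≤ u) :
    1 ≤ (Ak l).eval u / (Ak l).eval (1 / a ^ 5) ∧
    (Ak l).eval u / (Ak l).eval (1 / a ^ 5) - 1 ≤ 3 / a +
      (if 1 ≤ |u| then (3 * |u|) ^ (4 * l + 3) else 0) := by
  have ha0 : 0 < a := by linarith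
  have hρ : 0 < 1 / a ^ 5 := by positivity
  have hu0 : 0 < u := lt_of_lt_of_le hρ hu
  have hρ1 : 1 / a ^ 5 ≤ 1 := by
    rw [div_le_one (by positivity)]; exact one_le_pow₀ (by linarith)
  have hA : a ^ 6 / 3 ≤ (Ak l).eval (1 / a ^ 5) := by
    rw [hl]
    apply Ak_lower
    rw [← hl, pow_succ]
    field_simp
    linarith
  have ha6 : 64 ≤ a ^ 6 := by
    calc (64:ℝ) = 2 ^ 6 := by norm_num
      _ ≤ a ^ 6 := by gcongr
  set A := (Ak l).eval (1 / a ^ 5) with hAdef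
  have hA0 : 0 < A := by linarith
  have hA1 : 1 ≤ A := by linarith
  refine ⟨by rw [one_le_div hA0]; exact Ak_mono l hu, ?_⟩
  rw [div_sub_one hA0.ne', div_le_iff₀ hA0]
  have key : a ^ 5 ≤ 3 / a * A := by
    calc a ^ 5 = 3 / a * (a ^ 6 / 3) := by field_simp
      _ ≤ _ := by gcongr
  rw [abs_of_pos hu0]
  split_ifs with h
  · have h1 := Ak_far l u h
    have h2 := Ak_mid l (1 / a ^ 5) 1 hρ hρ1 le_rfl
    rw [← hAdef, one_div_one_div] at h2
    have h3 : (3 * u) ^ (4 * l + 3) ≤ (3 * u) ^ (4 * l + 3) * A :=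
      le_mul_of_one_le_right (by positivity) hA1
    linarith
  · have h2 := Ak_mid l (1 / a ^ 5) u hρ hu (by linarith)
    rw [← hAdef, one_div_one_div] at h2
    linarith

set_option maxHeartbeats 1000000 in
lemma up_core (l : ℕ) (a τ : ℝ) (ha : 2 ≤ a) (hl : a ^ 6 = 2 * l + 1)
    (hτ : |τ| + 60 / a ^ 2 ≤ 30 * a ^ 3) :
    ∃ p : ℝ[X], p.natDegree ≤ 8 * l + 2 ∧ l1 p ≤ 4 * 81 ^ (2 * l + 1) ∧
      (∀ x, (if τ ≤ x then (1:ℝ) else 0) ≤ p.eval x) ∧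
      ∀ x, (p.eval x - if τ ≤ x then (1:ℝ) else 0) ^ 2 ≤
        (Set.Icc (τ - 120 / a ^ 2) τ).indicator 1 x + 57 / a ^ 2 +
          5 * (x / (10 * a ^ 3)) ^ (2 * (8 * l + 6)) := by
  have ha0 : 0 < a := by linarith
  have ha3 : 0 < a ^ 3 := by positivity
  set ρ : ℝ := 1 / a ^ 5 with hρ
  set R : ℝ := 60 * a ^ 3 with hR
  have hR0 : 0 < R := by positivity
  have hRρ : R * ρ = 60 / a ^ 2 := by rw [hR, hρ]; field_simp
  have hρ0 : 0 < ρ := by positivity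
  set A := (Ak l).eval ρ with hAdef
  have hA : a ^ 6 / 3 ≤ A := by
    rw [hl]
    apply Ak_lower
    rw [← hl, hρ]
    field_simp
    nlinarith
  have ha6 : 64 ≤ a ^ 6 := by
    calc (64:ℝ) = 2 ^ 6 := by norm_num
      _ ≤ a ^ 6 := by gcongr
  have hA1 : 1 ≤ A := by linarith
  have hA0 : 0 < A := by linarith
  set L : ℝ[X] := C (1 / R) * X + C (ρ - τ / R) with hL
  set p : ℝ[X] := (C (1 / 2) * (1 + (C (1 / A) * Ak l).comp L)) ^ 2 with hp
  have hLe : ∀ x, L.eval x = (x - τ) / R + ρ := by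
    intro x; simp [hL]; ring
  have hpe : ∀ x, p.eval x = ((1 + (Ak l).eval ((x - τ) / R + ρ) / A) / 2) ^ 2 := by
    intro x
    simp only [hp, eval_pow, eval_mul, eval_C, eval_add, eval_one, eval_comp, hLe]
    congr 1; ring
  have hLd : L.natDegree ≤ 1 := by
    rw [hL]; exact natDegree_linear_le
  have hL1 : l1 L ≤ 1 := by
    rw [hL]
    refine (l1_add _ _).trans ?_
    have h1 : l1 (C (1 / R) * X) ≤ 1 / R := by
      refine (l1_mul _ _).trans ?_
      rw [l1_C, l1_X, abs_of_pos (by positivity), mul_one]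
    rw [l1_C]
    have h2 : |ρ - τ / R| ≤ 1 / 2 := by
      have : ρ - τ / R = (R * ρ - τ) / R := by field_simp
      rw [this, abs_div, abs_of_pos hR0, div_le_iff₀ hR0, hRρ]
      refine (abs_sub _ _).trans ?_
      rw [abs_of_pos (by positivity : 0 < 60 / a ^ 2), hR]
      linarith
    have h3 : 1 / R ≤ 1 / 2 := by
      apply one_div_le_one_div_of_le (by norm_num)
      rw [hR]
      have : (1:ℝ) ≤ a ^ 3 := one_le_pow₀ (by linarith)
      linarith
    linarith
  refine ⟨p, ?_, ?_, ?_, ?_⟩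
  · rw [hp]
    refine natDegree_pow_le.trans ?_
    have h1 : (C (1 / 2 : ℝ) * (1 + (C (1 / A) * Ak l).comp L)).natDegree ≤ 4 * l + 1 := by
      refine (natDegree_C_mul_le _ _).trans ?_
      refine (natDegree_add_le _ _).trans ?_
      rw [natDegree_one]
      refine max_le (Nat.zero_le _) ?_
      refine natDegree_comp_le.trans ?_
      have h2 := natDegree_C_mul_le (1 / A) (Ak l)
      have h3 := natDegree_Ak l
      calc _ ≤ (4 * l + 1) * 1 := Nat.mul_le_mul (h2.trans h3) hLd
        _ = _ := by ring
    omega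
  · rw [hp]
    refine (l1_pow _ _).trans ?_
    have h9 : (1:ℝ) ≤ 9 ^ (2 * l + 1) := one_le_pow₀ (by norm_num)
    have h1 : l1 (C (1 / 2 : ℝ) * (1 + (C (1 / A) * Ak l).comp L)) ≤ 2 * 9 ^ (2 * l + 1) := by
      refine (l1_mul _ _).trans ?_
      rw [l1_C]
      have h2 : l1 ((C (1 / A) * Ak l).comp L) ≤ 9 ^ (2 * l + 1) := by
        refine (l1_comp _ _ hL1).trans ((l1_mul _ _).trans ?_)
        rw [l1_C, abs_of_pos (by positivity)]
        have h3 : 1 / A ≤ 1 := by rw [div_le_one hA0]; exact hA1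
        calc 1 / A * l1 (Ak l) ≤ 1 * 9 ^ (2 * l + 1) :=
              mul_le_mul h3 (l1_Ak l) (l1_nonneg _) (by norm_num)
          _ = _ := one_mul _
      have h3 := l1_add 1 ((C (1 / A) * Ak l).comp L)
      rw [l1_one] at h3
      rw [abs_of_pos (by norm_num)]
      linarith
    calc _ ≤ (2 * 9 ^ (2 * l + 1) : ℝ) ^ 2 := pow_le_pow_left₀ (l1_nonneg _) h1 2
      _ = _ := by rw [mul_pow, ← pow_mul, mul_comm (2 * l + 1) 2, pow_mul]; norm_num
  · intro x
    rw [hpe]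
    split_ifs with h
    · have hu : ρ ≤ (x - τ) / R + ρ := by
        have : 0 ≤ (x - τ) / R := div_nonneg (by linarith) hR0.le
        linarith
      have h1 := (P_bound l a _ ha hl hu).1
      rw [← hρ, ← hAdef] at h1
      apply one_le_pow₀
      linarith
    · positivity
  · intro x
    rw [hpe]
    set u := (x - τ) / R + ρ with hu
    have hRu : R * u = x - τ + 60 / a ^ 2 := by
      rw [hu, mul_add, hRρ]; field_simp
    set P := (Ak l).eval u / A with hP
    have hX0 : 0 ≤ (x / (10 * a ^ 3)) ^ (2 * (8 * l + 6)) := by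
      rw [pow_mul]; positivity
    have hI0 : 0 ≤ (Set.Icc (τ - 120 / a ^ 2) τ).indicator (1 : ℝ → ℝ) x :=
      Set.indicator_nonneg (fun _ _ => zero_le_one) _
    -- the basic estimate
    set h : ℝ := if 1 ≤ |u| then (3 * |u|) ^ (4 * l + 3) else 0 with hh
    have hh0 : 0 ≤ h := by rw [hh]; split_ifs <;> positivity
    have hh4 : h ^ 4 ≤ (x / (10 * a ^ 3)) ^ (2 * (8 * l + 6)) := by
      rw [hh]
      split_ifs with h1
      · have h2 : R * |u| ≤ 2 * |x| := by
          have h3 : R * |u| ≤ |x| + |τ| + 60 / a ^ 2 := by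
            rw [← abs_of_pos hR0, ← abs_mul, hRu]
            refine (abs_add_le _ _).trans ?_
            rw [abs_of_pos (by positivity : 0 < 60 / a ^ 2)]
            linarith [abs_sub x τ]
          have h4 : R ≤ R * |u| := le_mul_of_one_le_right hR0.le h1
          linarith
        have h5 : 3 * |u| ≤ |x / (10 * a ^ 3)| := by
          rw [abs_div, abs_of_pos (by positivity : 0 < 10 * a ^ 3), le_div_iff₀ (by positivity)]
          rw [hR] at h2
          linarith
        calc ((3 * |u|) ^ (4 * l + 3)) ^ 4 ≤ (|x / (10 * a ^ 3)| ^ (4 * l + 3)) ^ 4 := by gcongr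
          _ = |x / (10 * a ^ 3)| ^ (2 * (8 * l + 6)) := by rw [← pow_mul]; congr 1; ring
          _ = _ := by rw [pow_mul, sq_abs, ← pow_mul]
      · simpa using hX0
    have hh2 : h ^ 2 ≤ h ^ 4 := by
      rw [hh]
      split_ifs with h1
      · apply pow_le_pow_right₀ _ (by norm_num)
        apply one_le_pow₀; linarith
      · simp
    have base : ∀ y, 0 ≤ y → y ≤ 3 / a + h → 2 * y ^ 2 + y ^ 4 / 8 ≤ 57 / a ^ 2 +
        5 * (x / (10 * a ^ 3)) ^ (2 * (8 * l + 6)) := by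
      intro y hy0 hy
      have e1 : y ^ 2 ≤ 2 * (3 / a) ^ 2 + 2 * h ^ 2 := by
        have := pow_le_pow_left₀ hy0 hy 2
        nlinarith [sq_nonneg (3 / a - h)]
      have e2 : y ^ 4 ≤ 8 * (3 / a) ^ 4 + 8 * h ^ 4 := by
        have h5 : (y ^ 2) ^ 2 ≤ (2 * (3 / a) ^ 2 + 2 * h ^ 2) ^ 2 :=
          pow_le_pow_left₀ (by positivity) e1 2
        nlinarith [sq_nonneg ((3 / a) ^ 2 - h ^ 2)]
      have e3 : (3 / a) ^ 2 = 9 / a ^ 2 := by rw [div_pow]; norm_num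
      have e4 : (3 / a) ^ 4 ≤ 20.25 / a ^ 2 := by
        rw [div_pow, div_le_div_iff₀ (by positivity) (by positivity)]
        have : 4 ≤ a ^ 2 := by nlinarith
        nlinarith [sq_nonneg (a ^ 2)]
      have e5 : 36 / a ^ 2 = 4 * (9 / a ^ 2) := by ring
      have e6 : 57 / a ^ 2 = 36 / a ^ 2 + 20.25 / a ^ 2 + 0.75 / a ^ 2 := by ring
      have e7 : 0 ≤ 0.75 / a ^ 2 := by positivity
      rw [e6]
      rw [e3] at e1
      linarith
    by_cases hx : τ ≤ x
    · rw [if_pos hx]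
      have hu1 : ρ ≤ u := by
        have : 0 ≤ (x - τ) / R := div_nonneg (by linarith) hR0.le
        rw [hu]; linarith
      have h1 := P_bound l a u ha hl hu1
      rw [← hρ, ← hAdef, ← hP, ← hh] at h1
      have h2 := base (P - 1) (by linarith) h1.2
      have h3 : (((1 + P) / 2) ^ 2 - 1) ^ 2 ≤ 2 * (P - 1) ^ 2 + (P - 1) ^ 4 / 8 := by
        nlinarith [sq_nonneg ((P - 1) - (P - 1) ^ 2 / 4)]
      linarith
    · rw [if_neg hx, sub_zero]
      by_cases hu1 : u ≤ -ρ
      · have h1 := P_bound l a (-u) ha hl (by linarith)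
        rw [← hρ, ← hAdef, abs_neg, ← hh, Ak_odd, neg_div, ← hP] at h1
        have h2 := base (-P - 1) (by linarith) h1.2
        have h3 : (((1 + P) / 2) ^ 2) ^ 2 ≤ 2 * (-P - 1) ^ 2 + (-P - 1) ^ 4 / 8 := by
          have : (((1 + P) / 2) ^ 2) ^ 2 = (-P - 1) ^ 4 / 16 := by ring
          rw [this]
          nlinarith [sq_nonneg (-P - 1), sq_nonneg ((-P - 1) ^ 2)]
        linarith
      · push Not at hx hu1
        have hmem : x ∈ Set.Icc (τ - 120 / a ^ 2) τ := by
          refine ⟨?_, hx.le⟩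
          have : R * (-ρ) < R * u := by gcongr
          rw [mul_neg, hRρ, hRu] at this
          have e : 120 / a ^ 2 = 60 / a ^ 2 + 60 / a ^ 2 := by ring
          rw [e]; linarith
        rw [Set.indicator_of_mem hmem, Pi.one_apply]
        have hu2 : u ≤ ρ := by
          have : (x - τ) / R ≤ 0 := div_nonpos_of_nonpos_of_nonneg (by linarith) hR0.le
          rw [hu]; linarith
        have p1 : P ≤ 1 := by rw [hP, div_le_one hA0]; exact Ak_mono l hu2
        have p2 : -1 ≤ P := by
          rw [hP, le_div_iff₀ hA0, neg_one_mul, hAdef, ← Ak_odd]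
          exact Ak_mono l hu1.le
        have h3 : (((1 + P) / 2) ^ 2) ^ 2 ≤ 1 := by
          apply pow_le_one₀ (by positivity)
          apply pow_le_one₀ (by linarith)
          linarith
        have : 0 ≤ 57 / a ^ 2 := by positivity
        linarith

end onedim

/-! ### Part G: one dimensional sandwich for all thresholds -/

section onedim2
open Polynomial

/-- the constant of the one dimensional lemma -/
def EE (T τ : ℝ) : ℝ := 1700 / (T ^ 2 * (T + |τ|) ^ 2)

lemma pow_mom_small (l : ℕ) (a : ℝ) (ha : 2 ≤ a) (hl : a ^ 6 = 2 * l + 1) :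
    ∫ x, (x / (10 * a ^ 3)) ^ (2 * (8 * l + 6)) ∂gam ≤ 2 / a ^ 2 := by
  have ha0 : 0 < a := by linarith
  have hl0 : (0:ℝ) ≤ l := Nat.cast_nonneg l
  simp_rw [div_pow]
  rw [integral_div]
  have h1 := gmom (8 * l + 6) (by omega)
  have h2 : (10 * a ^ 3) ^ (2 * (8 * l + 6)) = (100 * (2 * (l:ℝ) + 1)) ^ (8 * l + 6) := by
    rw [pow_mul, ← hl]; congr 1; ring
  rw [h2, div_le_iff₀ (by positivity)]
  refine h1.trans ?_
  have h3 : (6 * ((8 * l + 6 : ℕ):ℝ)) ≤ (1 / 2) * (100 * (2 * (l:ℝ) + 1)) := by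
    push_cast; linarith
  have h4 : (6 * ((8 * l + 6 : ℕ):ℝ)) ^ (8 * l + 6) ≤
      (1 / 2) ^ (8 * l + 6) * (100 * (2 * (l:ℝ) + 1)) ^ (8 * l + 6) := by
    rw [← mul_pow]; gcongr
  have h5 : ((1:ℝ) / 2) ^ (8 * l + 6) ≤ 1 / a ^ 2 := by
    rw [one_div_pow]
    apply one_div_le_one_div_of_le (by positivity)
    have h6 : (8 * l + 6) < 2 ^ (8 * l + 6) := Nat.lt_two_pow_self
    have h7 : ((8 * l + 6 : ℕ):ℝ) < 2 ^ (8 * l + 6) := by exact_mod_cast h6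
    have h8 : a ^ 2 ≤ a ^ 6 := pow_le_pow_right₀ (by linarith) (by norm_num)
    push_cast at h7
    rw [hl] at h8
    linarith
  have h9 : 0 < (100 * (2 * (l:ℝ) + 1)) ^ (8 * l + 6) := by positivity
  calc _ ≤ 2 * ((1 / 2) ^ (8 * l + 6) * (100 * (2 * (l:ℝ) + 1)) ^ (8 * l + 6)) := by gcongr
    _ ≤ 2 * (1 / a ^ 2 * (100 * (2 * (l:ℝ) + 1)) ^ (8 * l + 6)) := by gcongr
    _ = _ := by ring

lemma up_core_int (l : ℕ) (a τ : ℝ) (ha : 2 ≤ a) (hl : a ^ 6 = 2 * l + 1)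
    (hτ : |τ| + 60 / a ^ 2 ≤ 30 * a ^ 3) :
    ∃ p : ℝ[X], p.natDegree ≤ 8 * l + 2 ∧ l1 p ≤ 4 * 81 ^ (2 * l + 1) ∧
      (∀ x, (if τ ≤ x then (1:ℝ) else 0) ≤ p.eval x) ∧
      ∫ x, (p.eval x - if τ ≤ x then (1:ℝ) else 0) ^ 2 ∂gam ≤ 187 / a ^ 2 := by
  obtain ⟨p, h1, h2, h3, h4⟩ := up_core l a τ ha hl hτ
  refine ⟨p, h1, h2, h3, ?_⟩
  have ha0 : 0 < a := by linarith
  have i1 : Integrable (fun x => (Set.Icc (τ - 120 / a ^ 2) τ).indicator (1 : ℝ → ℝ) x) gam :=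
    (integrable_const (1:ℝ)).indicator measurableSet_Icc
  have i3 : Integrable (fun x => 5 * (x / (10 * a ^ 3)) ^ (2 * (8 * l + 6))) gam := by
    simp_rw [div_pow]
    exact ((gint_pow _).div_const _).const_mul _
  have hi : Integrable (fun x => (Set.Icc (τ - 120 / a ^ 2) τ).indicator (1 : ℝ → ℝ) x + 57 / a ^ 2 +
          5 * (x / (10 * a ^ 3)) ^ (2 * (8 * l + 6))) gam :=
    (i1.add (integrable_const _)).add i3
  refine (integral_mono_of_nonneg (Filter.Eventually.of_forall fun x => sq_nonneg _) hi
    (Filter.Eventually.of_forall h4)).trans ?_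
  have e2 := integral_add (i1.add (integrable_const (57 / a ^ 2))) i3
  have e1 := integral_add i1 (integrable_const (μ := gam) (57 / a ^ 2))
  simp only [Pi.add_apply] at e1 e2
  rw [e2, e1, integral_const_mul, integral_indicator_one measurableSet_Icc, integral_const]
  have b1 := gdens (τ - 120 / a ^ 2) τ (by linarith [show 0 ≤ 120 / a ^ 2 by positivity])
  have b2 := pow_mom_small l a ha hl
  simp only [probReal_univ, one_smul]
  have e : 187 / a ^ 2 = 120 / a ^ 2 / 2 + 57 / a ^ 2 + 5 * (2 / a ^ 2) + 60 / a ^ 2 := by ring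
  have : 0 ≤ 60 / a ^ 2 := by positivity
  linarith

lemma up_all (k : ℕ) (hk : 4 ≤ k) (T : ℝ) (hT : 1 ≤ T) (hTk : T ^ 12 = k) (τ : ℝ) :
    ∃ p : ℝ[X], p.natDegree ≤ k ∧ l1 p ≤ 324 * 512 ^ k ∧
      (∀ x, (if τ ≤ x then (1:ℝ) else 0) ≤ p.eval x) ∧
      ∫ x, (p.eval x - if τ ≤ x then (1:ℝ) else 0) ^ 2 ∂gam ≤ EE T τ := by
  have hT0 : 0 < T := by linarith
  have h512 : (1:ℝ) ≤ 324 * 512 ^ k := by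
    have : (1:ℝ) ≤ 512 ^ k := one_le_pow₀ (by norm_num)
    linarith
  -- tail bound
  have tail : T < |τ| → 288 / τ ^ 4 ≤ EE T τ := by
    intro h
    rw [EE]
    have h1 : τ ^ 4 = |τ| ^ 4 := by rw [show (4:ℕ) = 2 * 2 by norm_num, pow_mul, pow_mul, sq_abs]
    rw [h1]
    set s := |τ|
    have hs0 : 0 < s := by linarith
    rw [div_le_div_iff₀ (by positivity) (by positivity)]
    have h2 : T ^ 2 * (T + s) ^ 2 ≤ s ^ 2 * (s + s) ^ 2 := by gcongr
    nlinarith [sq_nonneg (s ^ 2)]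
  have m4 : ∀ g : ℝ → ℝ, (∀ x, (g x) ^ 2 ≤ (x / τ) ^ 4) → ∫ x, (g x) ^ 2 ∂gam ≤ 288 / τ ^ 4 := by
    intro g hg
    have i3 : Integrable (fun x => (x / τ) ^ 4) gam := by
      simp_rw [div_pow]
      exact ((gint_pow _).div_const _)
    refine (integral_mono_of_nonneg (Filter.Eventually.of_forall fun x => sq_nonneg _) i3
      (Filter.Eventually.of_forall hg)).trans ?_
    simp_rw [div_pow]
    rw [integral_div]
    have := gmom 2 (by norm_num)
    norm_num at this
    have h0 : 0 ≤ τ ^ 4 := by positivity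
    gcongr
  by_cases c1 : T < |τ|
  · by_cases c2 : 0 ≤ τ
    · rw [abs_of_nonneg c2] at c1
      have hτ0 : 0 < τ := by linarith
      refine ⟨(C (1 / τ) * X) ^ 2, ?_, ?_, ?_, ?_⟩
      · refine natDegree_pow_le.trans ?_
        have := (natDegree_C_mul_le (1 / τ) X).trans (natDegree_X_le (R := ℝ))
        omega
      · refine (l1_pow _ _).trans (le_trans ?_ h512)
        apply pow_le_one₀ (l1_nonneg _)
        refine (l1_mul _ _).trans ?_
        rw [l1_C, l1_X, mul_one, abs_of_pos (by positivity), div_le_one hτ0]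
        linarith
      · intro x
        split_ifs with h
        · simp only [eval_pow, eval_mul, eval_C, eval_X]
          apply one_le_pow₀
          rw [one_div_mul_eq_div, one_le_div hτ0]; exact h
        · simp only [eval_pow]; positivity
      · refine (m4 _ ?_).trans (tail (by rwa [abs_of_nonneg c2]))
        intro x
        simp only [eval_pow, eval_mul, eval_C, eval_X, one_div_mul_eq_div]
        split_ifs with h
        · have : 1 ≤ x / τ := by rw [one_le_div hτ0]; exact h
          nlinarith
        · rw [sub_zero, ← pow_mul]
    · push Not at c2
      refine ⟨1, by simp, by rw [l1_one]; exact h512, ?_, ?_⟩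
      · intro x; rw [eval_one]; split_ifs <;> norm_num
      · refine (m4 _ ?_).trans (tail c1)
        intro x
        rw [eval_one]
        split_ifs with h
        · simp; positivity
        · push Not at h
          have : 1 ≤ x / τ := by rw [one_le_div_of_neg c2]; exact h.le
          rw [sub_zero, one_pow]
          exact one_le_pow₀ this
  · push Not at c1
    have hE : 425 / T ^ 4 ≤ EE T τ := by
      rw [EE, div_le_div_iff₀ (by positivity) (by positivity)]
      have h2 : T ^ 2 * (T + |τ|) ^ 2 ≤ T ^ 2 * (T + T) ^ 2 := by gcongr
      nlinarith
    set l := (k - 2) / 8 with hl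
    have hl1 : 8 * l + 2 ≤ k := by omega
    have hl2 : k ≤ 9 * (2 * l + 1) := by omega
    set a : ℝ := (2 * (l:ℝ) + 1) ^ ((1:ℝ) / 6) with ha
    have ha6 : a ^ 6 = 2 * l + 1 := by
      rw [ha, ← Real.rpow_natCast, ← Real.rpow_mul (by positivity)]
      norm_num
    have ha0 : 0 < a := by rw [ha]; positivity
    have hTa : T ^ 2 ≤ 1.5 * a := by
      have h1 : (T ^ 2) ^ 6 ≤ (1.5 * a) ^ 6 := by
        rw [← pow_mul, mul_pow, ha6]
        norm_num
        rw [hTk]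
        have : (k:ℝ) ≤ 9 * (2 * l + 1) := by exact_mod_cast hl2
        have h0 : (0:ℝ) ≤ l := Nat.cast_nonneg l
        linarith
      exact le_of_pow_le_pow_left₀ (by norm_num) (by positivity) h1
    have hT4 : T ^ 4 ≤ 2.25 * a ^ 2 := by
      have : (T ^ 2) ^ 2 ≤ (1.5 * a) ^ 2 := by gcongr
      nlinarith
    by_cases c2 : a < 2
    · refine ⟨1, by simp, by rw [l1_one]; exact h512, ?_, ?_⟩
      · intro x; rw [eval_one]; split_ifs <;> norm_num
      · have h1 : (1:ℝ) ≤ EE T τ := by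
          refine le_trans ?_ hE
          rw [one_le_div (by positivity)]
          nlinarith
        refine le_trans ?_ h1
        have := integral_mono_of_nonneg (μ := gam)
          (f := fun x => (eval x (1:ℝ[X]) - if τ ≤ x then (1:ℝ) else 0) ^ 2)
          (g := fun _ => (1:ℝ)) (Filter.Eventually.of_forall fun x => sq_nonneg _)
          (integrable_const _) (Filter.Eventually.of_forall fun x => by
            simp only [eval_one]; split_ifs <;> norm_num)
        simpa using this
    · push Not at c2
      have hcond : |τ| + 60 / a ^ 2 ≤ 30 * a ^ 3 := by
        have h1 : 60 / a ^ 2 ≤ 15 := by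
          rw [div_le_iff₀ (by positivity)]; nlinarith
        have h2 : T ≤ T ^ 2 := by nlinarith
        have h3 : 4 * a ≤ a ^ 3 := by nlinarith [mul_pos ha0 ha0]
        linarith
      obtain ⟨p, h1, h2, h3, h4⟩ := up_core_int l a τ c2 ha6 hcond
      refine ⟨p, h1.trans hl1, h2.trans ?_, h3, h4.trans (le_trans ?_ hE)⟩
      · calc (4:ℝ) * 81 ^ (2 * l + 1) = 324 * (81 ^ 2) ^ l := by rw [pow_succ, pow_mul]; ring
          _ ≤ 324 * (512 ^ 8) ^ l := by gcongr; norm_num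
          _ = 324 * 512 ^ (8 * l) := by rw [← pow_mul]
          _ ≤ 324 * 512 ^ k := by gcongr; norm_num; omega
      · rw [div_le_div_iff₀ (by positivity) (by positivity)]
        nlinarith

lemma down_all (k : ℕ) (hk : 4 ≤ k) (T : ℝ) (hT : 1 ≤ T) (hTk : T ^ 12 = k) (τ : ℝ) :
    ∃ p : ℝ[X], p.natDegree ≤ k ∧ l1 p ≤ 325 * 512 ^ k ∧
      (∀ x, p.eval x ≤ (if τ < x then (1:ℝ) else 0)) ∧
      ∫ x, ((if τ < x then (1:ℝ) else 0) - p.eval x) ^ 2 ∂gam ≤ EE T τ := by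
  obtain ⟨q, h1, h2, h3, h4⟩ := up_all k hk T hT hTk (-τ)
  have key : ∀ x : ℝ, (if τ < x then (1:ℝ) else 0) = 1 - if -τ ≤ -x then (1:ℝ) else 0 := by
    intro x
    by_cases h : τ < x
    · rw [if_pos h, if_neg (by linarith)]; norm_num
    · rw [if_neg h, if_pos (by linarith)]; norm_num
  refine ⟨1 - q.comp (-X), ?_, ?_, ?_, ?_⟩
  · refine (natDegree_sub_le _ _).trans ?_
    rw [natDegree_one]
    refine max_le (Nat.zero_le _) (natDegree_comp_le.trans ?_)
    rw [natDegree_neg, natDegree_X, mul_one]; exact h1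
  · refine (l1_sub _ _).trans ?_
    have := l1_comp q (-X) (by rw [l1_neg, l1_X])
    rw [l1_one]
    have : (1:ℝ) ≤ 512 ^ k := one_le_pow₀ (by norm_num)
    linarith
  · intro x
    rw [key]
    have := h3 (-x)
    simp only [eval_sub, eval_one, eval_comp, eval_neg, eval_X]
    linarith
  · have hm : gam.map (fun x => -x) = gam := by
      have := gaussianReal_map_neg (μ := 0) (v := 1)
      simpa using this
    have e : EE T τ = EE T (-τ) := by rw [EE, EE, abs_neg]
    rw [e]
    refine le_trans (le_of_eq ?_) h4
    conv_rhs => rw [← hm]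
    rw [integral_map (by fun_prop)]
    · apply integral_congr_ae
      filter_upwards with x
      rw [key]
      simp only [eval_sub, eval_one, eval_comp, eval_neg, eval_X]
      ring
    · apply Measurable.aestronglyMeasurable
      apply Measurable.pow_const
      apply Measurable.sub
      · exact q.continuous.measurable
      · exact Measurable.ite measurableSet_Ici measurable_const measurable_const

end onedim2

/-! ### Part H: the partition and the reduction to one dimensional problems -/

section partition
open Polynomial

/-- index of the strip. -/
def Jx (ε : ℝ) (K : ℕ) (s : ℝ) : ℤ := max (-(K:ℤ) - 1) (min (K:ℤ) ⌊s / ε⌋)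

lemma Jx_mem (ε : ℝ) (K : ℕ) (s : ℝ) : Jx ε K s ∈ Finset.Icc (-(K:ℤ) - 1) (K:ℤ) := by
  rw [Finset.mem_Icc, Jx]; omega

lemma Jx_iff (ε : ℝ) (hε : 0 < ε) (K : ℕ) (s : ℝ) (j : ℤ)
    (hj : j ∈ Finset.Icc (-(K:ℤ) - 1) (K:ℤ)) :
    Jx ε K s = j ↔ (j = -(K:ℤ) - 1 ∨ (j:ℝ) * ε ≤ s) ∧ (j = (K:ℤ) ∨ s < ((j:ℝ) + 1) * ε) := by
  rw [Finset.mem_Icc] at hj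
  have h1 : (j:ℝ) * ε ≤ s ↔ j ≤ ⌊s / ε⌋ := by rw [Int.le_floor, le_div_iff₀ hε]
  have h2 : s < ((j:ℝ) + 1) * ε ↔ ⌊s / ε⌋ < j + 1 := by
    rw [Int.floor_lt, div_lt_iff₀ hε]; push_cast; rfl
  rw [h1, h2, Jx]
  omega

lemma Jx_meas (ε : ℝ) (K : ℕ) : Measurable (Jx ε K) := by
  unfold Jx
  have : Measurable (fun s : ℝ => ⌊s / ε⌋) := Int.measurable_floor.comp (by fun_prop)
  exact measurable_const.max (measurable_const.min this)

/-- the strips. -/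
def Sx {d : ℕ} (v : Fin d → ℝ) (ε : ℝ) (K : ℕ) (j : ℤ) : Set (Fin d → ℝ) :=
  {x | Jx ε K (dotp v x) = j}

open Classical in
/-- the partition. -/
def Cx {d : ℕ} (v : Fin d → ℝ) (ε : ℝ) (K : ℕ) : Finset (Set (Fin d → ℝ)) :=
  (Finset.Icc (-(K:ℤ) - 1) (K:ℤ)).image (Sx v ε K)

lemma Sx_mem_Cx {d : ℕ} (v : Fin d → ℝ) (ε : ℝ) (K : ℕ) (x : Fin d → ℝ) :
    Sx v ε K (Jx ε K (dotp v x)) ∈ Cx v ε K := by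
  rw [Cx, Finset.mem_image]
  exact ⟨_, Jx_mem ε K _, rfl⟩

lemma Cx_disj {d : ℕ} (v : Fin d → ℝ) (ε : ℝ) (K : ℕ) :
    ∀ A ∈ Cx v ε K, ∀ A' ∈ Cx v ε K, A ≠ A' → Disjoint A A' := by
  intro A hA A' hA' hne
  rw [Cx, Finset.mem_image] at hA hA'
  obtain ⟨j, -, rfl⟩ := hA
  obtain ⟨j', -, rfl⟩ := hA'
  rw [Set.disjoint_left]
  intro x hx hx'
  apply hne
  have h1 : Jx ε K (dotp v x) = j := hx
  have h2 : Jx ε K (dotp v x) = j' := hx'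
  rw [← h1, ← h2]

lemma Cx_cover {d : ℕ} (v : Fin d → ℝ) (ε : ℝ) (K : ℕ) :
    ⋃₀ (Cx v ε K : Set (Set (Fin d → ℝ))) = Set.univ := by
  rw [Set.eq_univ_iff_forall]
  intro x
  exact ⟨_, Sx_mem_Cx v ε K x, rfl⟩

lemma Cx_strip {d : ℕ} (v : Fin d → ℝ) (ε : ℝ) (hε : 0 < ε) (K : ℕ) :
    ∀ A ∈ Cx v ε K, ∃ a b : EReal, a < b ∧
          (a = ⊥ ∨ a = ⊤ ∨ ∃ j : ℤ, |j| ≤ (K:ℤ) ∧ a = (((j : ℝ) * ε : ℝ) : EReal)) ∧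
          (b = ⊥ ∨ b = ⊤ ∨ ∃ j : ℤ, |j| ≤ (K:ℤ) ∧ b = (((j : ℝ) * ε : ℝ) : EReal)) ∧
          A = {x | a ≤ ((dotp v x : ℝ) : EReal) ∧ ((dotp v x : ℝ) : EReal) < b} := by
  intro A hA
  rw [Cx, Finset.mem_image] at hA
  obtain ⟨j, hj, rfl⟩ := hA
  have hj' := Finset.mem_Icc.1 hj
  refine ⟨if j = -(K:ℤ) - 1 then ⊥ else (((j : ℝ) * ε : ℝ) : EReal),
    if j = (K:ℤ) then ⊤ else ((((j + 1 : ℤ) : ℝ) * ε : ℝ) : EReal), ?_, ?_, ?_, ?_⟩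
  · split_ifs with h1 h2 h2
    · exact bot_lt_top
    · exact EReal.bot_lt_coe _
    · exact EReal.coe_lt_top _
    · rw [EReal.coe_lt_coe_iff]
      push_cast
      linarith
  · split_ifs with h1
    · left; rfl
    · right; right
      refine ⟨j, ?_, rfl⟩
      rw [abs_le]; omega
  · split_ifs with h1
    · right; left; rfl
    · right; right
      refine ⟨j + 1, ?_, rfl⟩
      rw [abs_le]; omega
  · ext x
    simp only [Sx, Set.mem_ofPred_eq]
    rw [Jx_iff ε hε K _ j hj]
    apply and_congr
    · split_ifs with h1
      · simp [h1]
      · simp only [h1, false_or, EReal.coe_le_coe_iff]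
    · split_ifs with h1
      · simp [h1]
      · simp only [h1, false_or, EReal.coe_lt_coe_iff]
        push_cast; rfl

lemma Cx_sum {d : ℕ} (v : Fin d → ℝ) (ε : ℝ) (K : ℕ)
    (F : Set (Fin d → ℝ) → (Fin d → ℝ) → ℝ) (x : Fin d → ℝ) :
    ∑ A ∈ Cx v ε K, Set.indicator A (F A) x = F (Sx v ε K (Jx ε K (dotp v x))) x := by
  rw [Finset.sum_eq_single (Sx v ε K (Jx ε K (dotp v x)))]
  · rw [Set.indicator_of_mem]; rfl
  · intro A hA hne
    rw [Set.indicator_of_notMem]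
    intro hx
    exact Set.disjoint_left.1 (Cx_disj v ε K A hA _ (Sx_mem_Cx v ε K x) hne) hx rfl
  · intro h; exact absurd (Sx_mem_Cx v ε K x) h

lemma reduction {d : ℕ} (hd : 2 ≤ d) (v w : Fin d → ℝ) (hv : dotp v v = 1) (hw : dotp w w = 1)
    (hvw : dotp v w = 0) (ε : ℝ) (K : ℕ) (p q : ℤ → ℝ[X]) (k : ℕ) (B : ℝ)
    (hp1 : ∀ j, (p j).natDegree ≤ k) (hq1 : ∀ j, (q j).natDegree ≤ k)
    (hp2 : ∀ j, l1 (p j) ≤ B) (hq2 : ∀ j, l1 (q j) ≤ B)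
    (f : (Fin d → ℝ) → ℝ)
    (hf : ∀ x, (p (Jx ε K (dotp v x))).eval (dotp w x) ≤ f x ∧
      f x ≤ (q (Jx ε K (dotp v x))).eval (dotp w x))
    (ν B' : ℝ) (hB' : B * d ^ k ≤ B')
    (hν : ∑ j ∈ Finset.Icc (-(K:ℤ) - 1) (K:ℤ), gam.real {s | Jx ε K s = j} *
      ∫ t, ((q j).eval t - (p j).eval t) ^ 2 ∂gam ≤ ν) :
    SandwichL2 (Cx v ε K) f k ν B' := by
  classical
  set idx : Set (Fin d → ℝ) → ℤ := fun A => Jx ε K (dotp v (Classical.epsilon (· ∈ A))) with hidx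
  have hidx1 : ∀ x, idx (Sx v ε K (Jx ε K (dotp v x))) = Jx ε K (dotp v x) := by
    intro x
    have : Classical.epsilon (· ∈ Sx v ε K (Jx ε K (dotp v x))) ∈ Sx v ε K (Jx ε K (dotp v x)) :=
      Classical.epsilon_spec (p := (· ∈ Sx v ε K (Jx ε K (dotp v x)))) ⟨x, rfl⟩
    exact this
  refine ⟨fun A => lift w (p (idx A)), fun A => lift w (q (idx A)), ?_, ?_, ?_⟩
  · intro A _
    have h1 := lift_bounds hd w hw (p (idx A)) k (hp1 _)
    have h2 := lift_bounds hd w hw (q (idx A)) k (hq1 _)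
    have hd0 : (0:ℝ) ≤ (d:ℝ) ^ k := by positivity
    refine ⟨h1.1, h2.1, fun m => (h1.2 m).trans (le_trans ?_ hB'),
      fun m => (h2.2 m).trans (le_trans ?_ hB')⟩
    · exact mul_le_mul_of_nonneg_right (hp2 _) hd0
    · exact mul_le_mul_of_nonneg_right (hq2 _) hd0
  · intro x
    have h := hf x
    constructor
    · rw [Cx_sum v ε K (fun A y => MvPolynomial.eval y (lift w (p (idx A)))), eval_lift, hidx1]
      exact h.1
    · rw [Cx_sum v ε K (fun A y => MvPolynomial.eval y (lift w (q (idx A)))), eval_lift, hidx1]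
      exact h.2
  · refine le_trans (le_of_eq ?_) hν
    set G : ℝ × ℝ → ℝ := fun z => ∑ j ∈ Finset.Icc (-(K:ℤ) - 1) (K:ℤ),
      (Set.indicator {s | Jx ε K s = j} (1 : ℝ → ℝ) z.1) * ((q j).eval z.2 - (p j).eval z.2) ^ 2
      with hG
    have hms : ∀ j, MeasurableSet {s | Jx ε K s = j} := fun j =>
      (Jx_meas ε K) (measurableSet_singleton j)
    have e1 : ∀ x, (∑ A ∈ Cx v ε K, Set.indicator A
        (fun y => MvPolynomial.eval y (lift w (q (idx A))) -
          MvPolynomial.eval y (lift w (p (idx A)))) x) ^ 2 = G (dotp v x, dotp w x) := by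
      intro x
      rw [Cx_sum v ε K (fun A y => MvPolynomial.eval y (lift w (q (idx A))) -
        MvPolynomial.eval y (lift w (p (idx A)))), eval_lift, eval_lift, hidx1, hG]
      simp only
      rw [Finset.sum_eq_single (Jx ε K (dotp v x))]
      · simp
      · intro j _ hj
        rw [Set.indicator_of_notMem (by intro h; exact hj h.symm), zero_mul]
      · intro h; exact absurd (Jx_mem ε K _) h
    have hGm : Measurable G := by
      rw [hG]
      apply Finset.measurable_fun_sum
      intro j _
      apply Measurable.mul
      · exact (measurable_one.indicator (hms j)).comp measurable_fst
      · have := ((q j).continuous.measurable.sub (p j).continuous.measurable).pow_const 2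
        exact this.comp measurable_snd
    simp_rw [e1]
    have hmd : ∀ u : Fin d → ℝ, Measurable (fun x => dotp u x) := by
      intro u; unfold dotp; fun_prop
    have e2 := integral_map (μ := _root_.stdGaussian d) (φ := fun x => (dotp v x, dotp w x))
      ((hmd v).prodMk (hmd w)).aemeasurable (f := G) hGm.aestronglyMeasurable
    rw [map_pair v w hv hw hvw] at e2
    rw [← e2, hG, integral_finsetSum]
    · apply Finset.sum_congr rfl
      intro j _
      rw [integral_prod_mul (fun s => Set.indicator {s | Jx ε K s = j} (1 : ℝ → ℝ) s)
        (fun t => ((q j).eval t - (p j).eval t) ^ 2), integral_indicator_one (hms j)]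
    · intro j _
      apply Integrable.mul_prod (f := fun s => Set.indicator {s | Jx ε K s = j} (1 : ℝ → ℝ) s)
        (g := fun t => ((q j).eval t - (p j).eval t) ^ 2)
      · exact (integrable_const (1:ℝ)).indicator (hms j)
      · have := gint_poly ((q j - p j) ^ 2)
        simpa using this

end partition

/-! ### Part I: pairs and sums -/

section pairs
open Polynomial

/-- distribution function. -/
def Fg (x : ℝ) : ℝ := gam.real (Set.Iic x)

lemma Fg_mono {x y : ℝ} (h : x ≤ y) : Fg x ≤ Fg y :=
  measureReal_mono (Set.Iic_subset_Iic.2 h)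

lemma Fg_bd (x : ℝ) : 0 ≤ Fg x ∧ Fg x ≤ 1 := ⟨measureReal_nonneg, measureReal_le_one⟩

lemma Fg_Icc (x y : ℝ) (h : x ≤ y) : gam.real (Set.Icc x y) = Fg y - Fg x := by
  have : NullSingletonClass gam := nullSingletonClass_gaussianReal (by simp)
  have h1 : gam.real (Set.Icc x y) = gam.real (Set.Ioc x y) :=
    measureReal_congr Ioc_ae_eq_Icc.symm
  rw [h1, Fg, Fg, ← measureReal_sdiff (Set.Iic_subset_Iic.2 h) measurableSet_Iic]
  congr 1
  ext z
  simp [and_comm]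

lemma int_sq (p : ℝ[X]) (i : ℝ → ℝ) (hi : Measurable i) (h0 : ∀ x, |i x| ≤ 1) :
    Integrable (fun x => (p.eval x - i x) ^ 2) gam := by
  have h1 : Integrable (fun x => 2 * (p ^ 2).eval x + 2) gam :=
    ((gint_poly (p ^ 2)).const_mul 2).add (integrable_const _)
  refine h1.mono' ?_ ?_
  · exact ((p.continuous.measurable.sub hi).pow_const 2).aestronglyMeasurable
  · filter_upwards with x
    rw [Real.norm_eq_abs, abs_of_nonneg (sq_nonneg _), eval_pow]
    have h2 := abs_le.1 (h0 x)
    nlinarith [sq_nonneg (p.eval x + i x)]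

lemma pair_all (k : ℕ) (hk : 4 ≤ k) (T : ℝ) (hT : 1 ≤ T) (hTk : T ^ 12 = k) (lo hi : ℝ)
    (hlh : lo ≤ hi) :
    ∃ p q : ℝ[X], p.natDegree ≤ k ∧ q.natDegree ≤ k ∧ l1 p ≤ 325 * 512 ^ k ∧ l1 q ≤ 325 * 512 ^ k ∧
      (∀ x, p.eval x ≤ (if hi < x then (1:ℝ) else 0)) ∧
      (∀ x, (if lo ≤ x then (1:ℝ) else 0) ≤ q.eval x) ∧
      ∫ x, (q.eval x - p.eval x) ^ 2 ∂gam ≤ 3 * (EE T lo + EE T hi) + 3 * (Fg hi - Fg lo) := by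
  obtain ⟨q, q1, q2, q3, q4⟩ := up_all k hk T hT hTk lo
  obtain ⟨p, p1, p2, p3, p4⟩ := down_all k hk T hT hTk hi
  refine ⟨p, q, p1, q1, p2, q2.trans ?_, p3, q3, ?_⟩
  · have : (0:ℝ) ≤ 512 ^ k := by positivity
    linarith
  have m1 : Measurable (fun x : ℝ => if lo ≤ x then (1:ℝ) else 0) :=
    Measurable.ite measurableSet_Ici measurable_const measurable_const
  have m2 : Measurable (fun x : ℝ => if hi < x then (1:ℝ) else 0) :=
    Measurable.ite measurableSet_Ioi measurable_const measurable_const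
  have i1 := int_sq q _ m1 (fun x => by split_ifs <;> simp)
  have i2 := int_sq p _ m2 (fun x => by split_ifs <;> simp)
  have i2' : Integrable (fun x => ((if hi < x then (1:ℝ) else 0) - p.eval x) ^ 2) gam := by
    refine i2.congr (Filter.Eventually.of_forall fun x => ?_)
    simp only; ring
  have i3 : Integrable (fun x => (Set.Icc lo hi).indicator (1 : ℝ → ℝ) x) gam :=
    (integrable_const (1:ℝ)).indicator measurableSet_Icc
  have hi' := ((i1.add i2').add i3).const_mul 3
  refine (integral_mono_of_nonneg (Filter.Eventually.of_forall fun x => sq_nonneg _) hi'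
    (Filter.Eventually.of_forall fun x => ?_)).trans ?_
  · simp only [Pi.add_apply]
    have e : (Set.Icc lo hi).indicator (1 : ℝ → ℝ) x =
        (if lo ≤ x then (1:ℝ) else 0) - (if hi < x then (1:ℝ) else 0) := by
      by_cases h1 : lo ≤ x
      · by_cases h2 : hi < x
        · rw [Set.indicator_of_notMem (by intro h; linarith [h.2]), if_pos h1, if_pos h2]; norm_num
        · push Not at h2
          rw [Set.indicator_of_mem (by exact ⟨h1, h2⟩), if_pos h1, if_neg (by linarith)]; norm_num
      · push Not at h1
        rw [Set.indicator_of_notMem (by intro h; linarith [h.1]), if_neg (by linarith),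
          if_neg (by linarith)]; norm_num
    have e2 : (Set.Icc lo hi).indicator (1 : ℝ → ℝ) x =
        ((Set.Icc lo hi).indicator (1 : ℝ → ℝ) x) ^ 2 := by
      by_cases h : x ∈ Set.Icc lo hi <;> simp [h]
    rw [e2, e]
    set A := (if lo ≤ x then (1:ℝ) else 0)
    set B := (if hi < x then (1:ℝ) else 0)
    nlinarith [sq_nonneg ((q.eval x - A) - (B - p.eval x)), sq_nonneg ((q.eval x - A) - (A - B)),
      sq_nonneg ((B - p.eval x) - (A - B))]
  · rw [integral_const_mul, integral_add' (i1.add i2') i3, integral_add' i1 i2',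
      integral_indicator_one measurableSet_Icc, Fg_Icc lo hi hlh]
    linarith

lemma int_neg (p q : ℝ[X]) : ∫ x, ((q.comp (-X)).eval x - (p.comp (-X)).eval x) ^ 2 ∂gam =
    ∫ x, (q.eval x - p.eval x) ^ 2 ∂gam := by
  have hm : gam.map (fun x => -x) = gam := by
    have := gaussianReal_map_neg (μ := 0) (v := 1)
    simpa using this
  conv_rhs => rw [← hm]
  rw [integral_map (by fun_prop)]
  · simp
  · exact ((q.continuous.measurable.sub p.continuous.measurable).pow_const 2).aestronglyMeasurable

/-! measures of the strips -/

lemma strip_meas (ε : ℝ) (hε : 0 < ε) (K : ℕ) (j : ℤ) (h1 : -(K:ℤ) ≤ j) (h2 : j < K) :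
    gam.real {s | Jx ε K s = j} ≤ ε / 2 := by
  have : {s | Jx ε K s = j} ⊆ Set.Icc ((j:ℝ) * ε) ((j + 1) * ε) := by
    intro s hs
    have := (Jx_iff ε hε K s j (Finset.mem_Icc.2 (by omega))).1 hs
    exact ⟨this.1.resolve_left (by omega), (this.2.resolve_left (by omega)).le⟩
  refine (measureReal_mono this).trans ((gdens _ _ (by linarith)).trans (le_of_eq ?_))
  ring

lemma strip_tail1 (ε : ℝ) (hε : 0 < ε) (K : ℕ) :
    gam.real {s | Jx ε K s = (K:ℤ)} ≤ rexp (-((K * ε) ^ 2) / 2) := by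
  refine (measureReal_mono ?_).trans (gtail1 (K * ε) (by positivity))
  intro s hs
  have := ((Jx_iff ε hε K s K (Finset.mem_Icc.2 (by omega))).1 hs).1.resolve_left (by omega)
  simpa using this

lemma strip_tail2 (ε : ℝ) (hε : 0 < ε) (K : ℕ) :
    gam.real {s | Jx ε K s = -(K:ℤ) - 1} ≤ rexp (-((K * ε) ^ 2) / 2) := by
  refine (measureReal_mono ?_).trans (gtail2 (K * ε) (by positivity))
  intro s hs
  have := ((Jx_iff ε hε K s (-(K:ℤ) - 1) (Finset.mem_Icc.2 (by omega))).1 hs).2.resolve_left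
    (by omega)
  push_cast at this
  have h : s < -(K * ε) := by linarith
  exact h.le

lemma strip_total (ε : ℝ) (K : ℕ) :
    ∑ j ∈ Finset.Icc (-(K:ℤ) - 1) (K:ℤ), gam.real {s | Jx ε K s = j} ≤ 1 := by
  rw [← measureReal_biUnion_finset]
  · exact measureReal_le_one
  · intro i _ j _ hij
    rw [Function.onFun, Set.disjoint_left]
    intro s h1 h2
    exact hij (h1.symm.trans h2)
  · intro j _
    exact (Jx_meas ε K) (measurableSet_singleton j)

lemma sum_reindex (K : ℕ) (h : ℤ → ℝ) :
    ∑ j ∈ Finset.Icc (-(K:ℤ) - 1) (K:ℤ), h j =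
      ∑ n ∈ Finset.range (K + 1), (h n + h (-(n:ℤ) - 1)) := by
  induction K with
  | zero =>
    have : Finset.Icc (-((0:ℕ):ℤ) - 1) ((0:ℕ):ℤ) = {0, -1} := by
      ext j; simp; omega
    rw [this]; simp
  | succ K ih =>
    rw [Finset.sum_range_succ, ← ih]
    have : Finset.Icc (-((K + 1 : ℕ):ℤ) - 1) ((K + 1 : ℕ):ℤ) =
        insert ((K + 1 : ℕ):ℤ) (insert (-((K + 1 : ℕ):ℤ) - 1) (Finset.Icc (-(K:ℤ) - 1) (K:ℤ))) := by
      ext j; simp only [Finset.mem_insert, Finset.mem_Icc]; push_cast; omega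
    rw [this, Finset.sum_insert, Finset.sum_insert]
    · ring
    · simp only [Finset.mem_Icc]; push_cast; omega
    · simp only [Finset.mem_insert, Finset.mem_Icc]; push_cast; omega

lemma final_sum (K : ℕ) (hK : 1 ≤ K) (ε S : ℝ) (M Y G e : ℕ → ℝ) (hε : 0 < ε)
    (hM0 : ∀ n, 0 ≤ M n) (hM : ∀ n ≤ K, M n ≤ ε) (hY0 : Y 0 ≤ 1) (hYK : Y K ≤ 1)
    (hY : ∀ n, 1 ≤ n → n < K → Y n ≤ e n + 3 * G n)
    (hG0 : ∀ n, 0 ≤ G n) (hG : ∑ n ∈ Finset.Ico 1 K, G n ≤ 1)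
    (hS : ∑ n ∈ Finset.Ico 1 K, M n * e n ≤ S) :
    ∑ n ∈ Finset.range (K + 1), M n * Y n ≤ S + 5 * ε := by
  rw [Finset.sum_range_succ, Finset.range_eq_Ico, Finset.sum_eq_sum_Ico_succ_bot (by omega)]
  have h0 : M 0 * Y 0 ≤ ε := by nlinarith [hM0 0, hM 0 (by omega)]
  have h1 : M K * Y K ≤ ε := by nlinarith [hM0 K, hM K le_rfl]
  have h2 : ∑ n ∈ Finset.Ico (0 + 1) K, M n * Y n ≤
      ∑ n ∈ Finset.Ico 1 K, (M n * e n + 3 * ε * G n) := by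
    apply Finset.sum_le_sum
    intro n hn
    rw [Finset.mem_Ico] at hn
    have a1 := hY n hn.1 hn.2
    have a2 : M n * Y n ≤ M n * (e n + 3 * G n) := mul_le_mul_of_nonneg_left a1 (hM0 n)
    have a3 : M n * G n ≤ ε * G n := mul_le_mul_of_nonneg_right (hM n hn.2.le) (hG0 n)
    linarith
  rw [Finset.sum_add_distrib, ← Finset.mul_sum] at h2
  have h3 : 3 * ε * ∑ n ∈ Finset.Ico 1 K, G n ≤ 3 * ε * 1 := by gcongr
  linarith

lemma tele_abs (K : ℕ) (κ ε : ℝ) (hε : 0 < ε) :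
    ∑ n ∈ Finset.Ico 1 K, |Fg (κ * ((n + 1) * ε)) - Fg (κ * (n * ε))| ≤ 1 := by
  by_cases hK : K ≤ 1
  · rw [Finset.Ico_eq_empty (by omega)]; simp
  have h1 := Finset.sum_Ico_sub (fun n : ℕ => Fg (κ * (n * ε))) (m := 1) (n := K) (by omega)
  push_cast at h1
  rcases le_total 0 κ with h | h
  · have : ∀ n ∈ Finset.Ico 1 K, |Fg (κ * (((n:ℝ) + 1) * ε)) - Fg (κ * (n * ε))| =
        Fg (κ * (((n:ℝ) + 1) * ε)) - Fg (κ * (n * ε)) := by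
      intro n _
      rw [abs_of_nonneg]
      rw [sub_nonneg]
      apply Fg_mono
      gcongr
      linarith
    rw [Finset.sum_congr rfl this, h1]
    linarith [(Fg_bd (κ * (K * ε))).2, (Fg_bd (κ * (1 * ε))).1]
  · have : ∀ n ∈ Finset.Ico 1 K, |Fg (κ * (((n:ℝ) + 1) * ε)) - Fg (κ * (n * ε))| =
        -(Fg (κ * (((n:ℝ) + 1) * ε)) - Fg (κ * (n * ε))) := by
      intro n _
      rw [abs_of_nonpos]
      rw [sub_nonpos]
      apply Fg_mono
      apply mul_le_mul_of_nonpos_left _ h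
      gcongr
      linarith
    rw [Finset.sum_congr rfl this, Finset.sum_neg_distrib, h1]
    linarith [(Fg_bd (κ * (K * ε))).1, (Fg_bd (κ * (1 * ε))).2]

lemma tele_E (K : ℕ) (κ ε T : ℝ) (hκ : 0 < κ) (hε : 0 < ε) (hT : 1 ≤ T) :
    ∑ n ∈ Finset.Ico 1 K, ε * EE T (κ * (n * ε)) ≤ 1700 / (κ * T ^ 3) := by
  by_cases hK : K ≤ 1
  · rw [Finset.Ico_eq_empty (by omega)]; simp; positivity
  have hT0 : 0 < T := by linarith
  have h1 := Finset.sum_Ico_sub (fun n : ℕ => -(1700 / (κ * T ^ 2)) * (1 / (T + κ * ((n - 1 : ℝ) * ε))))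
    (m := 1) (n := K) (by omega)
  have h2 : ∀ n ∈ Finset.Ico 1 K, ε * EE T (κ * (n * ε)) ≤
      -(1700 / (κ * T ^ 2)) * (1 / (T + κ * (((n + 1 : ℕ) - 1 : ℝ) * ε)))
      - -(1700 / (κ * T ^ 2)) * (1 / (T + κ * ((n - 1 : ℝ) * ε))) := by
    intro n hn
    rw [Finset.mem_Ico] at hn
    have hn1 : (1:ℝ) ≤ n := by exact_mod_cast hn.1
    have hA : 0 < T + κ * ((n - 1 : ℝ) * ε) := by
      have : 0 ≤ κ * ((n - 1 : ℝ) * ε) := by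
        have : (0:ℝ) ≤ n - 1 := by linarith
        positivity
      linarith
    have hB : 0 < T + κ * (n * ε) := by positivity
    rw [EE, abs_of_nonneg (by positivity)]
    push_cast
    have e : (n:ℝ) + 1 - 1 = n := by ring
    rw [e]
    have e2 : -(1700 / (κ * T ^ 2)) * (1 / (T + κ * (n * ε)))
      - -(1700 / (κ * T ^ 2)) * (1 / (T + κ * ((n - 1 : ℝ) * ε))) =
      ε * (1700 / (T ^ 2 * ((T + κ * (n * ε)) * (T + κ * ((n - 1 : ℝ) * ε))))) := by
      have hBA : T + κ * (n * ε) = (T + κ * ((n - 1 : ℝ) * ε)) + κ * ε := by ring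
      rw [hBA] at hB ⊢
      generalize T + κ * ((n - 1 : ℝ) * ε) = A at hA hB
      field_simp
      ring
    rw [e2]
    gcongr ε * (1700 / (T ^ 2 * ?_))
    rw [sq]
    gcongr
    linarith
  refine (Finset.sum_le_sum h2).trans ?_
  rw [h1]
  push_cast
  have h3 : 0 ≤ 1700 / (κ * T ^ 2) * (1 / (T + κ * ((K - 1 : ℝ) * ε))) := by
    have hn1 : (1:ℝ) ≤ K := by exact_mod_cast (by omega : 1 ≤ K)
    have : (0:ℝ) ≤ K - 1 := by linarith
    positivity
  have h4 : 1700 / (κ * T ^ 3) = 1700 / (κ * T ^ 2) * (1 / (T + κ * ((1 - 1 : ℝ) * ε))) := by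
    rw [sub_self, zero_mul, mul_zero, add_zero]; field_simp
  rw [h4]
  linarith

end pairs

/-! ### Part K: assembly -/

section assembly
open Polynomial

lemma EE_nonneg (T τ : ℝ) : 0 ≤ EE T τ := by rw [EE]; positivity

lemma EE_le (T τ : ℝ) (hT : 1 ≤ T) : EE T τ ≤ 1700 / T ^ 4 := by
  rw [EE]
  have hT0 : 0 < T := by linarith
  apply div_le_div_of_nonneg_left (by norm_num) (by positivity)
  have : T ≤ T + |τ| := by linarith [abs_nonneg τ]
  calc T ^ 4 = T ^ 2 * T ^ 2 := by ring
    _ ≤ _ := by gcongr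

lemma EE_anti (T x y : ℝ) (hT : 1 ≤ T) (hx : 0 ≤ x) (hxy : x ≤ y) : EE T y ≤ EE T x := by
  rw [EE, EE, abs_of_nonneg hx, abs_of_nonneg (hx.trans hxy)]
  have hT0 : 0 < T := by linarith
  apply div_le_div_of_nonneg_left (by norm_num) (by positivity)
  gcongr

/-- polynomials for a strip -/
lemma strip_polys (k : ℕ) (hk : 4 ≤ k) (T : ℝ) (hT : 1 ≤ T) (hTk : T ^ 12 = k) (κ ε : ℝ)
    (hε : 0 < ε) (K : ℕ) (n : ℕ) :
    ∃ p q : ℝ[X], p.natDegree ≤ k ∧ q.natDegree ≤ k ∧ l1 p ≤ 325 * 512 ^ k ∧ l1 q ≤ 325 * 512 ^ k ∧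
      (∀ s : ℝ, n * ε ≤ s → (n < K → s ≤ (n + 1) * ε) → ∀ x,
        p.eval x ≤ (if κ * s < x then (1:ℝ) else 0) ∧ (if κ * s ≤ x then (1:ℝ) else 0) ≤ q.eval x) ∧
      (n = 0 ∨ n = K → ∫ x, (q.eval x - p.eval x) ^ 2 ∂gam ≤ 1) ∧
      (1 ≤ n → n < K → ∫ x, (q.eval x - p.eval x) ^ 2 ∂gam ≤
        3 * (EE T (κ * (n * ε)) + EE T (κ * ((n + 1) * ε))) +
        3 * |Fg (κ * ((n + 1) * ε)) - Fg (κ * (n * ε))|) := by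
  have h512 : (1:ℝ) ≤ 325 * 512 ^ k := by
    have : (1:ℝ) ≤ 512 ^ k := one_le_pow₀ (by norm_num)
    linarith
  by_cases hn : 1 ≤ n ∧ n < K
  · have main : ∃ p q : ℝ[X], p.natDegree ≤ k ∧ q.natDegree ≤ k ∧ l1 p ≤ 325 * 512 ^ k ∧
        l1 q ≤ 325 * 512 ^ k ∧
        (∀ x, p.eval x ≤ (if max (κ * (n * ε)) (κ * ((n + 1) * ε)) < x then (1:ℝ) else 0)) ∧
        (∀ x, (if min (κ * (n * ε)) (κ * ((n + 1) * ε)) ≤ x then (1:ℝ) else 0) ≤ q.eval x) ∧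
        ∫ x, (q.eval x - p.eval x) ^ 2 ∂gam ≤
        3 * (EE T (κ * (n * ε)) + EE T (κ * ((n + 1) * ε))) +
        3 * |Fg (κ * ((n + 1) * ε)) - Fg (κ * (n * ε))| := by
      obtain ⟨p, q, h1, h2, h3, h4, h5, h6, h7⟩ := pair_all k hk T hT hTk
        (min (κ * (n * ε)) (κ * ((n + 1) * ε))) (max (κ * (n * ε)) (κ * ((n + 1) * ε))) min_le_max
      refine ⟨p, q, h1, h2, h3, h4, h5, h6, h7.trans ?_⟩
      rcases le_total (κ * (n * ε)) (κ * ((n + 1) * ε)) with h | h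
      · rw [min_eq_left h, max_eq_right h]
        linarith [le_abs_self (Fg (κ * ((n + 1) * ε)) - Fg (κ * (n * ε)))]
      · rw [min_eq_right h, max_eq_left h]
        linarith [neg_le_abs (Fg (κ * ((n + 1) * ε)) - Fg (κ * (n * ε)))]
    obtain ⟨p, q, h1, h2, h3, h4, h5, h6, h7⟩ := main
    refine ⟨p, q, h1, h2, h3, h4, ?_, by intro h; omega, fun _ _ => h7⟩
    intro s hs1 hs2 x
    have hs2 := hs2 hn.2
    have b1 : min (κ * (n * ε)) (κ * ((n + 1) * ε)) ≤ κ * s := by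
      rcases le_total 0 κ with h | h
      · exact (min_le_left _ _).trans (mul_le_mul_of_nonneg_left hs1 h)
      · exact (min_le_right _ _).trans (mul_le_mul_of_nonpos_left hs2 h)
    have b2 : κ * s ≤ max (κ * (n * ε)) (κ * ((n + 1) * ε)) := by
      rcases le_total 0 κ with h | h
      · exact (mul_le_mul_of_nonneg_left hs2 h).trans (le_max_right _ _)
      · exact (mul_le_mul_of_nonpos_left hs1 h).trans (le_max_left _ _)
    constructor
    · refine (h5 x).trans ?_
      by_cases c : max (κ * (n * ε)) (κ * ((n + 1) * ε)) < x
      · rw [if_pos c, if_pos (lt_of_le_of_lt b2 c)]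
      · rw [if_neg c]; split_ifs <;> norm_num
    · refine le_trans ?_ (h6 x)
      by_cases c : κ * s ≤ x
      · rw [if_pos c, if_pos (b1.trans c)]
      · rw [if_neg c]; split_ifs <;> norm_num
  · refine ⟨0, 1, by simp, by simp, ?_, by rw [l1_one]; exact h512, ?_, ?_, ?_⟩
    · have : l1 (0 : ℝ[X]) = 0 := by simp [l1]
      rw [this]; linarith
    · intro s _ _ x
      rw [eval_zero, eval_one]
      constructor <;> split_ifs <;> norm_num
    · intro _; simp
    · intro h1 h2; exact absurd ⟨h1, h2⟩ hn

lemma sgn_cond1 (s y : ℝ) (hs : 0 ≤ s) :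
    (if sgn s = sgn y then (0:ℝ) else 1) = if y < 0 then 1 else 0 := by
  unfold sgn
  rw [if_pos hs]
  by_cases h : 0 ≤ y
  · rw [if_pos h, if_pos rfl, if_neg (by linarith)]
  · rw [if_neg h, if_neg (by norm_num), if_pos (by linarith)]

lemma sgn_cond2 (s y : ℝ) (hs : s < 0) :
    (if sgn s = sgn y then (0:ℝ) else 1) = if 0 ≤ y then 1 else 0 := by
  unfold sgn
  rw [if_neg (by linarith : ¬ 0 ≤ s)]
  by_cases h : 0 ≤ y
  · rw [if_pos h, if_neg (by norm_num), if_pos h]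
  · rw [if_neg h, if_pos rfl, if_neg h]

lemma M_bound (ε : ℝ) (hε : 0 < ε) (K : ℕ) (hKt : rexp (-((K * ε) ^ 2) / 2) ≤ ε / 2)
    (n : ℕ) (hn : n ≤ K) :
    gam.real {s | Jx ε K s = (n:ℤ)} + gam.real {s | Jx ε K s = -(n:ℤ) - 1} ≤ ε := by
  rcases Nat.lt_or_eq_of_le hn with h | h
  · have h1 := strip_meas ε hε K n (by omega) (by omega)
    have h2 := strip_meas ε hε K (-(n:ℤ) - 1) (by omega) (by omega)
    linarith
  · subst h
    have h1 := strip_tail1 ε hε n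
    have h2 := strip_tail2 ε hε n
    linarith

set_option maxHeartbeats 1000000 in
lemma generic {d : ℕ} (hd : 2 ≤ d) (v v' w : Fin d → ℝ) (hv : dotp v v = 1) (hw : dotp w w = 1)
    (hvw : dotp v w = 0) (c σ : ℝ) (hσ : 0 < σ)
    (hdec : ∀ x, dotp v' x = c * dotp v x + σ * dotp w x)
    (ε : ℝ) (hε : 0 < ε) (K : ℕ) (hK : 1 ≤ K) (hKt : rexp (-((K * ε) ^ 2) / 2) ≤ ε / 2)
    (k : ℕ) (hk : 4 ≤ k) (T : ℝ) (hT : 1 ≤ T) (hTk : T ^ 12 = k) (S : ℝ)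
    (hS1 : 1 ≤ c / σ → 10200 / ((c / σ) * T ^ 3) ≤ S)
    (hS2 : c / σ < 1 → 10200 / T ^ 4 ≤ S) (B' : ℝ) (hB' : 325 * 512 ^ k * (d:ℝ) ^ k ≤ B') :
    SandwichL2 (Cx v ε K) (fun x => if sgn (dotp v x) = sgn (dotp v' x) then 0 else 1) k
      (S + 5 * ε) B' := by
  set κ := c / σ with hκ
  have hcκ : c = κ * σ := by rw [hκ]; field_simp
  choose P Q hP1 hQ1 hP2 hQ2 hPQ hY1 hY2 using fun n => strip_polys k hk T hT hTk κ ε hε K n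
  have hcomp : ∀ p : ℝ[X], p.natDegree ≤ k → (p.comp (-X)).natDegree ≤ k := by
    intro p hp
    refine natDegree_comp_le.trans ?_
    rw [natDegree_neg, natDegree_X, mul_one]; exact hp
  have hcl1 : ∀ p : ℝ[X], l1 (p.comp (-X)) ≤ l1 p := fun p =>
    l1_comp p (-X) (by rw [l1_neg, l1_X])
  refine reduction hd v w hv hw hvw ε K
    (fun j => if 0 ≤ j then (P j.toNat).comp (-X) else P (-j - 1).toNat)
    (fun j => if 0 ≤ j then (Q j.toNat).comp (-X) else Q (-j - 1).toNat) k (325 * 512 ^ k)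
    ?_ ?_ ?_ ?_ _ ?_ _ _ hB' ?_
  · intro j; beta_reduce; split_ifs
    · exact hcomp _ (hP1 _)
    · exact hP1 _
  · intro j; beta_reduce; split_ifs
    · exact hcomp _ (hQ1 _)
    · exact hQ1 _
  · intro j; beta_reduce; split_ifs
    · exact (hcl1 _).trans (hP2 _)
    · exact hP2 _
  · intro j; beta_reduce; split_ifs
    · exact (hcl1 _).trans (hQ2 _)
    · exact hQ2 _
  · intro x
    beta_reduce
    set s := dotp v x with hs
    set t := dotp w x with ht
    set j := Jx ε K s with hj
    have hjm := Jx_mem ε K s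
    rw [← hj, Finset.mem_Icc] at hjm
    have hji := (Jx_iff ε hε K s j (Finset.mem_Icc.2 hjm)).1 hj.symm
    rw [hdec x, ← hs, ← ht]
    by_cases h0 : 0 ≤ j
    · rw [if_pos h0, if_pos h0]
      obtain ⟨n, hn⟩ := Int.eq_ofNat_of_zero_le h0
      rw [hn] at hji ⊢
      simp only [Int.toNat_natCast]
      have a1 : (n:ℝ) * ε ≤ s := by simpa using hji.1.resolve_left (by omega)
      have a2 : n < K → s ≤ ((n:ℝ) + 1) * ε := by
        intro h; simpa using (hji.2.resolve_left (by omega)).le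
      have s0 : 0 ≤ s := le_trans (by positivity) a1
      rw [sgn_cond1 _ _ s0]
      have h := hPQ n s a1 a2 (-t)
      simp only [eval_comp, eval_neg, eval_X]
      have e : c * s + σ * t < 0 ↔ κ * s < -t := by
        have : c * s + σ * t = σ * (κ * s + t) := by rw [hcκ]; ring
        rw [this]
        constructor
        · intro h; by_contra h'; push Not at h'; nlinarith
        · intro h; nlinarith
      simp only [e]
      refine ⟨h.1, le_trans ?_ h.2⟩
      by_cases c1 : κ * s < -t
      · rw [if_pos c1, if_pos c1.le]
      · rw [if_neg c1]; split_ifs <;> norm_num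
    · rw [if_neg h0, if_neg h0]
      obtain ⟨n, hn⟩ := Int.eq_ofNat_of_zero_le (show 0 ≤ -j - 1 by omega)
      have hj2 : j = -(n:ℤ) - 1 := by omega
      rw [hn]
      simp only [Int.toNat_natCast]
      rw [hj2] at hji
      have a1 : s < -((n:ℝ) * ε) := by
        have := hji.2.resolve_left (by omega)
        push_cast at this; linarith
      have a2 : n < K → -s ≤ ((n:ℝ) + 1) * ε := by
        intro h
        have := hji.1.resolve_left (by omega)
        push_cast at this; linarith
      have s0 : s < 0 := lt_of_lt_of_le a1 (by have : 0 ≤ (n:ℝ) * ε := by positivity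
                                               linarith)
      rw [sgn_cond2 _ _ s0]
      have h := hPQ n (-s) (by linarith) a2 t
      have e : 0 ≤ c * s + σ * t ↔ κ * (-s) ≤ t := by
        have : c * s + σ * t = σ * (κ * s + t) := by rw [hcκ]; ring
        rw [this]
        constructor
        · intro h; by_contra h'; push Not at h'; nlinarith
        · intro h
          apply mul_nonneg hσ.le; linarith
      simp only [e]
      refine ⟨h.1.trans ?_, h.2⟩
      by_cases c1 : κ * (-s) < t
      · rw [if_pos c1, if_pos c1.le]
      · rw [if_neg c1]; split_ifs <;> norm_num
  · rw [sum_reindex]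
    set M : ℕ → ℝ := fun n => gam.real {s | Jx ε K s = (n:ℤ)} +
      gam.real {s | Jx ε K s = -(n:ℤ) - 1} with hM
    set Y : ℕ → ℝ := fun n => ∫ x, ((Q n).eval x - (P n).eval x) ^ 2 ∂gam with hY
    have e1 : ∀ n ∈ Finset.range (K + 1), (gam.real {s | Jx ε K s = (n:ℤ)} *
      ∫ t, ((if 0 ≤ (n:ℤ) then (Q (n:ℤ).toNat).comp (-X) else Q (-(n:ℤ) - 1).toNat).eval t -
        (if 0 ≤ (n:ℤ) then (P (n:ℤ).toNat).comp (-X) else P (-(n:ℤ) - 1).toNat).eval t) ^ 2 ∂gam +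
      gam.real {s | Jx ε K s = -(n:ℤ) - 1} *
      ∫ t, ((if 0 ≤ -(n:ℤ) - 1 then (Q (-(n:ℤ) - 1).toNat).comp (-X) else
          Q (-(-(n:ℤ) - 1) - 1).toNat).eval t -
        (if 0 ≤ -(n:ℤ) - 1 then (P (-(n:ℤ) - 1).toNat).comp (-X) else
          P (-(-(n:ℤ) - 1) - 1).toNat).eval t) ^ 2 ∂gam) = M n * Y n := by
      intro n _
      have i1 : 0 ≤ (n:ℤ) := by omega
      have i2 : ¬ (0 ≤ -(n:ℤ) - 1) := by omega
      have i3 : (-(-(n:ℤ) - 1) - 1) = n := by ring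
      rw [if_pos i1, if_pos i1, if_neg i2, if_neg i2, i3, Int.toNat_natCast, int_neg, hM, hY]
      ring
    rw [Finset.sum_congr rfl e1]
    have hM0 : ∀ n, 0 ≤ M n := fun n => add_nonneg measureReal_nonneg measureReal_nonneg
    have hMε : ∀ n ≤ K, M n ≤ ε := fun n hn => M_bound ε hε K hKt n hn
    refine final_sum K hK ε S M Y (fun n => |Fg (κ * ((n + 1) * ε)) - Fg (κ * (n * ε))|)
      (fun n => 3 * (EE T (κ * (n * ε)) + EE T (κ * ((n + 1) * ε)))) hε hM0 hMε
      (hY1 0 (Or.inl rfl)) (hY1 K (Or.inr rfl)) (fun n h1 h2 => hY2 n h1 h2)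
      (fun n => abs_nonneg _) (tele_abs K κ ε hε) ?_
    by_cases c1 : 1 ≤ κ
    · refine le_trans ?_ (hS1 c1)
      have h1 : ∀ n ∈ Finset.Ico 1 K, M n * (3 * (EE T (κ * (n * ε)) + EE T (κ * ((n + 1) * ε)))) ≤
          6 * (ε * EE T (κ * (n * ε))) := by
        intro n hn
        rw [Finset.mem_Ico] at hn
        have h2 : EE T (κ * (((n:ℝ) + 1) * ε)) ≤ EE T (κ * (n * ε)) := by
          apply EE_anti T _ _ hT (by positivity)
          gcongr
          linarith
        have h3 := EE_nonneg T (κ * (n * ε))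
        have h4 := EE_nonneg T (κ * (((n:ℝ) + 1) * ε))
        calc M n * (3 * (EE T (κ * (n * ε)) + EE T (κ * ((n + 1) * ε))))
            ≤ ε * (3 * (EE T (κ * (n * ε)) + EE T (κ * (n * ε)))) := by
              apply mul_le_mul (hMε n hn.2.le) (by linarith) (by positivity) hε.le
          _ = _ := by ring
      refine (Finset.sum_le_sum h1).trans ?_
      rw [← Finset.mul_sum]
      have h2 := tele_E K κ ε T (by linarith) hε hT
      calc _ ≤ 6 * (1700 / (κ * T ^ 3)) := by gcongr
        _ = _ := by ring
    · push Not at c1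
      refine le_trans ?_ (hS2 c1)
      have h1 : ∀ n ∈ Finset.Ico 1 K, M n * (3 * (EE T (κ * (n * ε)) + EE T (κ * ((n + 1) * ε)))) ≤
          M n * (10200 / T ^ 4) := by
        intro n _
        apply mul_le_mul_of_nonneg_left _ (hM0 n)
        have h2 := EE_le T (κ * (n * ε)) hT
        have h3 := EE_le T (κ * (((n:ℝ) + 1) * ε)) hT
        have h4 : 10200 / T ^ 4 = 6 * (1700 / T ^ 4) := by ring
        rw [h4]; linarith
      refine (Finset.sum_le_sum h1).trans ?_
      rw [← Finset.sum_mul]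
      have h2 : ∑ n ∈ Finset.Ico 1 K, M n ≤ 1 := by
        have h3 := strip_total ε K
        rw [sum_reindex K (fun j => gam.real {s | Jx ε K s = j})] at h3
        refine le_trans ?_ h3
        apply Finset.sum_le_sum_of_subset_of_nonneg
        · intro n hn
          rw [Finset.mem_Ico] at hn
          rw [Finset.mem_range]; omega
        · intro n _ _; exact hM0 n
      calc _ ≤ 1 * (10200 / T ^ 4) := by gcongr
        _ = _ := one_mul _

lemma degenerate {d : ℕ} (hd : 2 ≤ d) (v v' w : Fin d → ℝ) (hv : dotp v v = 1) (hw : dotp w w = 1)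
    (hvw : dotp v w = 0) (c : ℝ) (hc : c = 1 ∨ c = -1)
    (hdec : ∀ x, dotp v' x = c * dotp v x)
    (ε : ℝ) (hε : 0 < ε) (K : ℕ) (hK : 1 ≤ K) (k : ℕ)
    (S : ℝ) (hS : ε ≤ S) (B' : ℝ) (hB' : 325 * 512 ^ k * (d:ℝ) ^ k ≤ B') :
    SandwichL2 (Cx v ε K) (fun x => if sgn (dotp v x) = sgn (dotp v' x) then 0 else 1) k S B' := by
  have h512 : (1:ℝ) ≤ 325 * 512 ^ k := by
    have : (1:ℝ) ≤ 512 ^ k := one_le_pow₀ (by norm_num)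
    linarith
  have hl0 : l1 (0 : ℝ[X]) ≤ 325 * 512 ^ k := by
    have : l1 (0 : ℝ[X]) = 0 := by simp [l1]
    rw [this]; linarith
  have hl1 : l1 (1 : ℝ[X]) ≤ 325 * 512 ^ k := by rw [l1_one]; exact h512
  have key : ∀ p q : ℤ → ℝ[X], (∀ j, p j = 0 ∨ p j = 1) → (∀ j, q j = 0 ∨ q j = 1) →
      (∀ j, j ≠ 0 → p j = q j) → (∀ x, (p (Jx ε K (dotp v x))).eval (dotp w x) ≤
        (if sgn (dotp v x) = sgn (dotp v' x) then (0:ℝ) else 1) ∧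
        (if sgn (dotp v x) = sgn (dotp v' x) then (0:ℝ) else 1) ≤
          (q (Jx ε K (dotp v x))).eval (dotp w x)) →
      SandwichL2 (Cx v ε K) (fun x => if sgn (dotp v x) = sgn (dotp v' x) then 0 else 1) k S B' := by
    intro p q hp hq hpq hf
    refine reduction hd v w hv hw hvw ε K p q k (325 * 512 ^ k) ?_ ?_ ?_ ?_ _ hf _ _ hB' ?_
    · intro j; rcases hp j with h | h <;> rw [h] <;> simp
    · intro j; rcases hq j with h | h <;> rw [h] <;> simp
    · intro j; rcases hp j with h | h <;> rw [h] <;> assumption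
    · intro j; rcases hq j with h | h <;> rw [h] <;> assumption
    · rw [Finset.sum_eq_single 0]
      · have h1 := strip_meas ε hε K 0 (by omega) (by omega)
        have h2 : ∫ t, ((q 0).eval t - (p 0).eval t) ^ 2 ∂gam ≤ 1 := by
          rcases hp 0 with h | h <;> rcases hq 0 with h' | h' <;> rw [h, h'] <;> simp
        have h3 : 0 ≤ gam.real {s | Jx ε K s = 0} := measureReal_nonneg
        nlinarith
      · intro j _ hj
        rw [hpq j hj]; simp
      · intro h
        exfalso; apply h
        rw [Finset.mem_Icc]; omega
  rcases hc with hc | hc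
  · apply key (fun _ => 0) (fun _ => 0) (fun _ => Or.inl rfl) (fun _ => Or.inl rfl) (fun _ _ => rfl)
    intro x
    rw [hdec, hc, one_mul, if_pos rfl]; simp
  · apply key (fun j => if j = 0 then 0 else 1) (fun _ => 1) _ (fun _ => Or.inr rfl)
    · intro j hj; simp [hj]
    · intro x
      rw [hdec, hc]
      constructor
      · by_cases h0 : Jx ε K (dotp v x) = 0
        · simp only [h0, if_true, eval_zero]; split_ifs <;> norm_num
        · simp only [h0, if_false, eval_one]
          rw [if_neg]
          intro h
          apply h0
          have hs : dotp v x = 0 := by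
            by_contra hne
            unfold sgn at h
            rcases lt_or_gt_of_ne hne with h1 | h1
            · rw [if_neg (by linarith), if_pos (by linarith)] at h; norm_num at h
            · rw [if_pos (by linarith), if_neg (by linarith)] at h; norm_num at h
          rw [hs, Jx, zero_div, Int.floor_zero]; omega
      · simp only [eval_one]; split_ifs <;> norm_num
    · intro j; beta_reduce; split_ifs <;> simp

lemma angle_facts (c σ : ℝ) (hσ : 0 < σ) (h : c ^ 2 + σ ^ 2 = 1) :
    0 ≤ arccos c ∧ (1 ≤ c / σ → σ / c ≤ 2 * arccos c) ∧ (c / σ < 1 → 1 ≤ 2 * arccos c) := by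
  have h0 := Real.arccos_nonneg c
  have hc1 : -1 ≤ c := by nlinarith
  have hc2 : c ≤ 1 := by nlinarith
  have hs : sin (arccos c) = σ := by
    rw [Real.sin_arccos, show 1 - c ^ 2 = σ ^ 2 by linarith, Real.sqrt_sq hσ.le]
  have hle : σ ≤ arccos c := by rw [← hs]; exact Real.sin_le h0
  refine ⟨h0, ?_, ?_⟩
  · intro h1
    rw [one_le_div hσ] at h1
    have hc : 1 / 2 ≤ c := by nlinarith
    rw [div_le_iff₀ (by linarith)]
    nlinarith
  · intro h1
    rw [div_lt_one hσ] at h1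
    by_contra h2
    push Not at h2
    have h3 := Real.one_sub_sq_div_two_le_cos (x := arccos c)
    rw [Real.cos_arccos hc1 hc2] at h3
    nlinarith

end assembly


lemma final_K (ε : ℝ) (hε : ε ∈ Set.Ioo (0:ℝ) 1) (k₁ : ℤ)
    (hk₁ : k₁ = ⌈2 * Real.sqrt (Real.log (2 / ε)) / ε⌉) :
    ∃ K : ℕ, k₁ = (K : ℤ) ∧ 1 ≤ K ∧ rexp (-((K * ε) ^ 2) / 2) ≤ ε / 2 := by
  obtain ⟨h0, h1⟩ := hε
  have hl : 0 < Real.log (2 / ε) := Real.log_pos (by rw [lt_div_iff₀ h0]; linarith)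
  have hs : 0 < Real.sqrt (Real.log (2 / ε)) := Real.sqrt_pos.2 hl
  have hk : 0 < k₁ := by rw [hk₁]; exact Int.ceil_pos.2 (by positivity)
  obtain ⟨K, hK⟩ := Int.eq_ofNat_of_zero_le hk.le
  refine ⟨K, hK, by omega, ?_⟩
  have h2 : 2 * Real.sqrt (Real.log (2 / ε)) / ε ≤ (K : ℝ) := by
    have := Int.le_ceil (2 * Real.sqrt (Real.log (2 / ε)) / ε)
    rw [← hk₁, hK] at this
    simpa using this
  rw [div_le_iff₀ h0] at h2
  have h3 : 4 * Real.log (2 / ε) ≤ (K * ε) ^ 2 := by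
    have h4 := pow_le_pow_left₀ (by positivity) h2 2
    rw [mul_pow, Real.sq_sqrt hl.le] at h4
    linarith
  have h5 : ε / 2 = rexp (- Real.log (2 / ε)) := by
    rw [Real.exp_neg, Real.exp_log (by positivity), inv_div]
  rw [h5]
  apply Real.exp_le_exp.2
  linarith

lemma final_B (d : ℕ) (hd : 2 ≤ d) (k : ℕ) :
    325 * 512 ^ k * (d : ℝ) ^ k ≤ 20400 * (d : ℝ) ^ (10 * k) := by
  have hd' : (2 : ℝ) ≤ d := by exact_mod_cast hd
  have h1 : (512 : ℝ) ^ k ≤ (d : ℝ) ^ (9 * k) := by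
    rw [pow_mul]
    apply pow_le_pow_left₀ (by norm_num)
    calc (512 : ℝ) = 2 ^ 9 := by norm_num
      _ ≤ _ := pow_le_pow_left₀ (by norm_num) hd' 9
  have h2 : (d : ℝ) ^ (10 * k) = (d : ℝ) ^ (9 * k) * (d : ℝ) ^ k := by
    rw [← pow_add]; congr 1; ring
  rw [h2]
  have h3 : (512 : ℝ) ^ k * (d : ℝ) ^ k ≤ (d : ℝ) ^ (9 * k) * (d : ℝ) ^ k :=
    mul_le_mul_of_nonneg_right h1 (by positivity)
  have h4 : 0 ≤ (d : ℝ) ^ (9 * k) * (d : ℝ) ^ k := by positivity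
  nlinarith

lemma final_T (k : ℕ) (hk : 4 ≤ k) :
    ∃ T : ℝ, 1 ≤ T ∧ T ^ 12 = k ∧ T ^ 3 = (k : ℝ) ^ ((1 : ℝ) / 4) := by
  have hk' : (4 : ℝ) ≤ k := by exact_mod_cast hk
  refine ⟨(k : ℝ) ^ ((1 : ℝ) / 12), Real.one_le_rpow (by linarith) (by norm_num), ?_, ?_⟩
  · rw [← Real.rpow_natCast, ← Real.rpow_mul (by linarith)]; norm_num
  · rw [← Real.rpow_natCast, ← Real.rpow_mul (by linarith)]; norm_num

lemma final_log (k : ℕ) (hk : 4 ≤ k) : 1 ≤ (Real.log ((k : ℝ) + 2)) ^ 5 := by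
  have hk' : (4 : ℝ) ≤ k := by exact_mod_cast hk
  apply one_le_pow₀
  rw [Real.le_log_iff_exp_le (by linarith)]
  have := Real.exp_one_lt_d9
  linarith


/-- The disagreement region of two halfspaces admits a partition of `ℝ^d` into strips
`{a ≤ v·x < b}` (with endpoints among `±∞` and `j·ε`, `|j| ≤ k₁ = ⌈2√(log(2/ε))/ε⌉`)
with respect to which its indicator has
`(C·∠(v,v')·(log(k₂+2))⁵/k₂^{1/4} + 10ε, C·d^{10k₂})`-sandwiching degree at most `k₂`
in `L2` norm under `N(0, I_d)`, for all unit vectors `v'` simultaneously. -/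
theorem sandwiching_degree_disagreement_L2 :
    ∃ C : ℝ, 1 ≤ C ∧
      ∀ (d : ℕ), 2 ≤ d → ∀ ε : ℝ, ε ∈ Set.Ioo (0:ℝ) 1 → ∀ k₂ : ℕ, 4 ≤ k₂ →
      ∀ v : Fin d → ℝ, IsUnitVec v →
      ∀ k₁ : ℤ, k₁ = ⌈2 * Real.sqrt (Real.log (2 / ε)) / ε⌉ →
      ∃ 𝒞 : Finset (Set (Fin d → ℝ)),
        (∀ A ∈ 𝒞, ∃ a b : EReal, a < b ∧
          (a = ⊥ ∨ a = ⊤ ∨ ∃ j : ℤ, |j| ≤ k₁ ∧ a = (((j : ℝ) * ε : ℝ) : EReal)) ∧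
          (b = ⊥ ∨ b = ⊤ ∨ ∃ j : ℤ, |j| ≤ k₁ ∧ b = (((j : ℝ) * ε : ℝ) : EReal)) ∧
          A = {x | a ≤ ((dotp v x : ℝ) : EReal) ∧ ((dotp v x : ℝ) : EReal) < b}) ∧
        (∀ A ∈ 𝒞, ∀ A' ∈ 𝒞, A ≠ A' → Disjoint A A') ∧
        ⋃₀ (𝒞 : Set (Set (Fin d → ℝ))) = Set.univ ∧
        ∀ v' : Fin d → ℝ, IsUnitVec v' →
          SandwichL2 𝒞 (fun x => if sgn (dotp v x) = sgn (dotp v' x) then 0 else 1) k₂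
            (C * angleOf v v' * (Real.log ((k₂ : ℝ) + 2)) ^ 5 / (k₂ : ℝ) ^ ((1:ℝ)/4)
              + 10 * ε)
            (C * (d : ℝ) ^ (10 * k₂)) := by
  refine ⟨20400, by norm_num, ?_⟩
  intro d hd ε hε k₂ hk v hv k₁ hk₁
  obtain ⟨K, hKk, hK, hKt⟩ := final_K ε hε k₁ hk₁
  have hε0 := hε.1
  subst hKk
  refine ⟨Cx v ε K, Cx_strip v ε hε0 K, Cx_disj v ε K, Cx_cover v ε K, ?_⟩
  intro v' hv'
  obtain ⟨w, σ, hσ, hw, hvw, hcs, hdec⟩ := exists_decomp hd v v' hv hv'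
  obtain ⟨T, hT, hTk, hT3⟩ := final_T k₂ hk
  have hL := final_log k₂ hk
  have hB := final_B d hd k₂
  have hθ0 : 0 ≤ angleOf v v' := Real.arccos_nonneg _
  rw [← hT3]
  have hT30 : 0 < T ^ 3 := by positivity
  have hmain : 20400 * angleOf v v' / T ^ 3 ≤
      20400 * angleOf v v' * (Real.log ((k₂ : ℝ) + 2)) ^ 5 / T ^ 3 := by
    apply div_le_div_of_nonneg_right _ hT30.le
    exact le_mul_of_one_le_right (by positivity) hL
  have hnn : 0 ≤ 20400 * angleOf v v' / T ^ 3 := by positivity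
  rcases hσ.eq_or_lt with h0 | h0
  · subst h0
    have hc : dotp v v' = 1 ∨ dotp v v' = -1 := by
      have h1 : dotp v v' ^ 2 = 1 := by linarith
      simpa using h1
    refine degenerate hd v v' w hv hw hvw _ hc (fun x => by rw [hdec x]; ring) ε hε0 K hK k₂ _
      (by linarith) _ hB
  · obtain ⟨-, ha1, ha2⟩ := angle_facts _ σ h0 hcs
    have key := generic hd v v' w hv hw hvw (dotp v v') σ h0 hdec ε hε0 K hK hKt k₂ hk T hT hTk
      (20400 * angleOf v v' * (Real.log ((k₂ : ℝ) + 2)) ^ 5 / T ^ 3 + 5 * ε) ?_ ?_ _ hB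
    · convert key using 1; ring
    · intro h
      have h1 := ha1 h
      have e : 10200 / (dotp v v' / σ * T ^ 3) = 10200 * (σ / dotp v v') / T ^ 3 := by
        rw [← div_div, div_div_eq_mul_div, mul_div_assoc]
      have h2 : 10200 * (σ / dotp v v') / T ^ 3 ≤ 20400 * angleOf v v' / T ^ 3 := by
        apply div_le_div_of_nonneg_right _ hT30.le
        unfold angleOf; linarith
      rw [e]; linarith
    · intro h
      have h1 := ha2 h
      have e : 10200 / T ^ 4 ≤ 10200 / T ^ 3 :=
        div_le_div_of_nonneg_left (by norm_num) hT30 (pow_le_pow_right₀ hT (by norm_num))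
      have h2 : 10200 / T ^ 3 ≤ 20400 * angleOf v v' / T ^ 3 := by
        apply div_le_div_of_nonneg_right _ hT30.le
        unfold angleOf; linarith
      linarith

end
end

section
/- There exists an absolute constant C ≥ 1 such that for every integer k ≥ 2 and every real t, there exist real polynomials p_down and p_up in one variable, each of degree at most k and with all coefficients bounded by 2^{10k} in absolute value, such that p_down(z) ≤ 1_{z ≤ t} ≤ p_up(z) for all z ∈ ℝ, and E_{z∼N(0,1)}[p_up(z) − p_down(z)] ≤ C·(log(k+2))³/√k; moreover if |t| ≥ 1 the polynomials can be chosen so that additionally E_{z∼N(0,1)}[p_up(z) − p_down(z)] ≤ C/t². -/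
open MeasureTheory ProbabilityTheory Real

noncomputable section

namespace Sandwich

/-- `p` has `ℓ¹` coefficient norm at most `B`, via a dominating polynomial. -/
def NB (p : Polynomial ℝ) (B : ℝ) : Prop :=
  ∃ P : Polynomial ℝ, (∀ n, |p.coeff n| ≤ P.coeff n) ∧ P.eval 1 ≤ B

lemma eval_one_nonneg {P : Polynomial ℝ} (h : ∀ n, 0 ≤ P.coeff n) : 0 ≤ P.eval 1 := by
  rw [Polynomial.eval_eq_sum_range]
  exact Finset.sum_nonneg fun i _ => by simpa using h i

lemma coeff_le_eval_one {P : Polynomial ℝ} (h : ∀ n, 0 ≤ P.coeff n) (n : ℕ) :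
    P.coeff n ≤ P.eval 1 := by
  by_cases hn : n ≤ P.natDegree
  · rw [Polynomial.eval_eq_sum_range]
    have := Finset.single_le_sum (f := fun i => P.coeff i * 1 ^ i)
      (s := Finset.range (P.natDegree + 1)) (fun i _ => by simpa using h i)
      (Finset.mem_range.2 (Nat.lt_succ_of_le hn))
    simpa using this
  · rw [Polynomial.coeff_eq_zero_of_natDegree_lt (by omega)]
    exact eval_one_nonneg h

lemma NB.coeff {p : Polynomial ℝ} {B : ℝ} (h : NB p B) (n : ℕ) : |p.coeff n| ≤ B := by
  obtain ⟨P, h1, h2⟩ := h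
  exact (h1 n).trans ((coeff_le_eval_one (fun m => (abs_nonneg _).trans (h1 m)) n).trans h2)

lemma NB.nonneg {p : Polynomial ℝ} {B : ℝ} (h : NB p B) : 0 ≤ B :=
  (abs_nonneg _).trans (h.coeff 0)

lemma NB.mono {p : Polynomial ℝ} {B B' : ℝ} (h : NB p B) (hB : B ≤ B') : NB p B' := by
  obtain ⟨P, h1, h2⟩ := h
  exact ⟨P, h1, h2.trans hB⟩

lemma NB.add {p q : Polynomial ℝ} {B B' : ℝ} (h : NB p B) (h' : NB q B') :
    NB (p + q) (B + B') := by
  obtain ⟨P, h1, h2⟩ := h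
  obtain ⟨Q, h3, h4⟩ := h'
  refine ⟨P + Q, fun n => ?_, by rw [Polynomial.eval_add]; linarith⟩
  rw [Polynomial.coeff_add, Polynomial.coeff_add]
  exact (abs_add_le _ _).trans (add_le_add (h1 n) (h3 n))

lemma NB.neg {p : Polynomial ℝ} {B : ℝ} (h : NB p B) : NB (-p) B := by
  obtain ⟨P, h1, h2⟩ := h
  exact ⟨P, fun n => by simpa using h1 n, h2⟩

lemma NB.sub {p q : Polynomial ℝ} {B B' : ℝ} (h : NB p B) (h' : NB q B') :
    NB (p - q) (B + B') := by
  rw [sub_eq_add_neg]; exact h.add h'.neg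

lemma NB.mul {p q : Polynomial ℝ} {B B' : ℝ} (h : NB p B) (h' : NB q B') :
    NB (p * q) (B * B') := by
  have hB := h.nonneg
  obtain ⟨P, h1, h2⟩ := h
  obtain ⟨Q, h3, h4⟩ := h'
  refine ⟨P * Q, fun n => ?_, ?_⟩
  · rw [Polynomial.coeff_mul, Polynomial.coeff_mul]
    refine (Finset.abs_sum_le_sum_abs _ _).trans (Finset.sum_le_sum fun x _ => ?_)
    rw [abs_mul]
    exact mul_le_mul (h1 _) (h3 _) (abs_nonneg _) ((abs_nonneg _).trans (h1 _))
  · rw [Polynomial.eval_mul]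
    exact mul_le_mul h2 h4 (eval_one_nonneg fun m => (abs_nonneg _).trans (h3 m)) hB

lemma NB_C (c : ℝ) : NB (Polynomial.C c) |c| := by
  refine ⟨Polynomial.C |c|, fun n => ?_, by simp⟩
  rw [Polynomial.coeff_C, Polynomial.coeff_C]
  split_ifs <;> simp

lemma NB_X : NB (Polynomial.X) 1 := by
  refine ⟨Polynomial.X, fun n => ?_, by simp⟩
  rw [Polynomial.coeff_X]
  split_ifs <;> simp

lemma NB_one : NB (1 : Polynomial ℝ) 1 := by
  simpa using NB_C 1

lemma NB.pow {p : Polynomial ℝ} {B : ℝ} (h : NB p B) (n : ℕ) : NB (p ^ n) (B ^ n) := by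
  induction n with
  | zero => simpa using NB_one
  | succ n ih => rw [pow_succ, pow_succ]; exact ih.mul h

lemma NB.sum (s : Finset ℕ) (f : ℕ → Polynomial ℝ) (B : ℕ → ℝ)
    (h : ∀ i ∈ s, NB (f i) (B i)) : NB (∑ i ∈ s, f i) (∑ i ∈ s, B i) := by
  classical
  induction s using Finset.induction_on with
  | empty => exact ⟨0, by simp, by simp⟩
  | insert i s hi ih =>
    rw [Finset.sum_insert hi, Finset.sum_insert hi]
    exact (h i (by simp)).add (ih fun j hj => h j (by simp [hj]))

lemma NB.comp {p q : Polynomial ℝ} {B : ℝ} (h : NB p B) (hq : NB q 1) : NB (p.comp q) B := by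
  obtain ⟨P, h1, h2⟩ := h
  have e : p.comp q = ∑ i ∈ Finset.range (max p.natDegree P.natDegree + 1),
      Polynomial.C (p.coeff i) * q ^ i := by
    rw [Polynomial.comp, Polynomial.eval₂_eq_sum_range' _ (n := max p.natDegree P.natDegree + 1)]
    omega
  rw [e]
  refine (NB.sum _ _ (fun i => P.coeff i) fun i _ => ?_).mono ?_
  · have := (NB_C (p.coeff i)).mul (hq.pow i)
    exact this.mono (by simpa using h1 i)
  · refine le_trans (le_of_eq ?_) h2
    rw [Polynomial.eval_eq_sum_range' (n := max p.natDegree P.natDegree + 1) (by omega)]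
    simp

lemma NB.eval_le {p : Polynomial ℝ} {B : ℝ} (h : NB p B) {x : ℝ} (hx : |x| ≤ 1) :
    |p.eval x| ≤ B := by
  have := (h.comp (q := Polynomial.C x) ((NB_C x).mono hx)).coeff 0
  simpa using this

/-- Antiderivative. -/
def antid (p : Polynomial ℝ) : Polynomial ℝ :=
  ∑ i ∈ Finset.range (p.natDegree + 1), Polynomial.C (p.coeff i / (i + 1)) * Polynomial.X ^ (i + 1)

lemma antid_deriv (p : Polynomial ℝ) : Polynomial.derivative (antid p) = p := by
  rw [antid, Polynomial.derivative_sum]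
  conv_rhs => rw [Polynomial.as_sum_range_C_mul_X_pow p]
  refine Finset.sum_congr rfl fun i _ => ?_
  rw [Polynomial.derivative_C_mul_X_pow]
  have : ((i : ℝ) + 1) ≠ 0 := by positivity
  simp only [Nat.add_sub_cancel]
  congr 2
  push_cast
  field_simp

lemma antid_natDegree (p : Polynomial ℝ) : (antid p).natDegree ≤ p.natDegree + 1 := by
  refine Polynomial.natDegree_sum_le_of_forall_le _ _ fun i hi => ?_
  have := Finset.mem_range.1 hi
  exact (Polynomial.natDegree_C_mul_X_pow_le _ _).trans (by omega)

lemma NB.antid {p : Polynomial ℝ} {B : ℝ} (h : NB p B) : NB (antid p) B := by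
  obtain ⟨P, h1, h2⟩ := h
  refine ⟨Polynomial.X * P, fun n => ?_, by simpa using h2⟩
  cases n with
  | zero => simp [Sandwich.antid]
  | succ n =>
    have e : (Sandwich.antid p).coeff (n + 1) = p.coeff n / (n + 1) := by
      have h3 := congrArg (fun q => Polynomial.coeff q n) (antid_deriv p)
      simp only [Polynomial.coeff_derivative] at h3
      have : ((n : ℝ) + 1) ≠ 0 := by positivity
      field_simp
      exact h3
    rw [e, Polynomial.coeff_X_mul, abs_div]
    refine le_trans (div_le_self (abs_nonneg _) ?_) (h1 n)
    rw [abs_of_nonneg (by positivity)]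
    have : (0 : ℝ) ≤ n := by positivity
    linarith

lemma mvt_le (p : Polynomial ℝ) {a b M : ℝ} (hab : a ≤ b)
    (h : ∀ v, a ≤ v → v ≤ b → p.eval v ≤ M) :
    (antid p).eval b - (antid p).eval a ≤ M * (b - a) := by
  refine (convex_Icc a b).image_sub_le_mul_sub_of_deriv_le (f := fun x => (antid p).eval x)
    (Polynomial.continuous _).continuousOn (Polynomial.differentiable _).differentiableOn ?_
    a ⟨le_rfl, hab⟩ b ⟨hab, le_rfl⟩ hab
  intro x hx
  have hx := interior_subset hx
  rw [Polynomial.deriv, antid_deriv]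
  exact h x hx.1 hx.2

lemma le_mvt (p : Polynomial ℝ) {a b M : ℝ} (hab : a ≤ b)
    (h : ∀ v, a ≤ v → v ≤ b → M ≤ p.eval v) :
    M * (b - a) ≤ (antid p).eval b - (antid p).eval a := by
  refine (convex_Icc a b).mul_sub_le_image_sub_of_le_deriv (f := fun x => (antid p).eval x)
    (Polynomial.continuous _).continuousOn (Polynomial.differentiable _).differentiableOn ?_
    a ⟨le_rfl, hab⟩ b ⟨hab, le_rfl⟩ hab
  intro x hx
  have hx := interior_subset hx
  rw [Polynomial.deriv, antid_deriv]
  exact h x hx.1 hx.2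

open Polynomial.Chebyshev in
lemma T_lower (n : ℕ) {a x : ℝ} (ha : 0 ≤ a) (hx : cosh a ≤ x) :
    cosh (n * a) ≤ (T ℝ n).eval x := by
  have h1 : 1 ≤ x := (one_le_cosh a).trans hx
  obtain ⟨b, hb, rfl⟩ : ∃ b, 0 ≤ b ∧ cosh b = x :=
    ⟨arcosh x, arcosh_nonneg h1, cosh_arcosh h1⟩
  rw [cosh_le_cosh, abs_of_nonneg ha, abs_of_nonneg hb] at hx
  rw [T_real_cosh, cosh_le_cosh, abs_of_nonneg (by positivity), abs_of_nonneg (by positivity)]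
  push_cast
  gcongr

open Polynomial.Chebyshev in
lemma T_upper_pos (n : ℕ) {x : ℝ} (h1 : 1 ≤ x) :
    |(T ℝ n).eval x| ≤ (2 * x) ^ n := by
  obtain ⟨b, hb, rfl⟩ : ∃ b, 0 ≤ b ∧ cosh b = x :=
    ⟨arcosh x, arcosh_nonneg h1, cosh_arcosh h1⟩
  rw [T_real_cosh, abs_of_pos (cosh_pos _)]
  have h2 : exp b ≤ 2 * cosh b := by
    rw [cosh_eq]; linarith [exp_pos (-b)]
  calc cosh ((n : ℤ) * b) ≤ exp (n * b) := by
        rw [cosh_eq]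
        push_cast
        have : exp (-(n * b)) ≤ exp (n * b) := by
          apply exp_le_exp.2
          have : 0 ≤ n * b := by positivity
          linarith
        linarith
    _ = (exp b) ^ n := by rw [← exp_nat_mul]
    _ ≤ _ := by gcongr

open Polynomial.Chebyshev in
lemma T_upper (n : ℕ) {x y : ℝ} (hy : 1 ≤ y) (hx : |x| ≤ y) :
    |(T ℝ n).eval x| ≤ (2 * y) ^ n := by
  rcases le_total |x| 1 with h | h
  · exact (abs_eval_T_real_le_one _ h).trans (one_le_pow₀ (by linarith))
  · have : |(T ℝ n).eval x| ≤ (2 * |x|) ^ n := by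
      rcases le_total 0 x with h0 | h0
      · rw [abs_of_nonneg h0] at h ⊢
        exact T_upper_pos n h
      · rw [abs_of_nonpos h0] at h ⊢
        have := T_upper_pos n h
        rwa [T_eval_neg, abs_mul, Int.cast_negOnePow_natCast, abs_pow, abs_neg, abs_one, one_pow, one_mul] at this
    exact this.trans (by gcongr)

open Polynomial.Chebyshev in
lemma NB_T_comp {q : Polynomial ℝ} (hq : NB q 3) (n : ℕ) : NB ((T ℝ n).comp q) (7 ^ n) := by
  induction n using Nat.twoStepInduction with
  | zero => simpa using NB_one
  | one => simpa using hq.mono (by norm_num)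
  | more n ih1 ih2 =>
    have := (((NB_C 2).mul hq).mul ih2).sub ih1
    have e : ((n + 1 + 1 : ℕ) : ℤ) = (n : ℤ) + 2 := by push_cast; ring
    have e2 : ((n + 1 : ℕ) : ℤ) = (n : ℤ) + 1 := by push_cast; ring
    rw [e2] at this
    rw [e, T_add_two]
    simp only [Polynomial.sub_comp, Polynomial.mul_comp, Polynomial.X_comp, Polynomial.ofNat_comp]
    have h2 : ((2 : ℕ) : Polynomial ℝ) = Polynomial.C 2 := rfl
    rw [h2]
    refine NB.mono this ?_
    have h7 : (0:ℝ) < 7 ^ n := by positivity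
    rw [abs_of_pos (by norm_num : (0:ℝ) < 2), pow_succ (7:ℝ) (n + 1), pow_succ (7:ℝ) n]
    linarith

end Sandwich

namespace Sandwich
set_option maxHeartbeats 1000000 in
open Polynomial.Chebyshev in
lemma core (n : ℕ) (a h : ℝ) (ha : 0 < a) (hh : h = sinh (a / 2)) (h8 : h ≤ 1 / 8)
    (hM : 1 ≤ 2 * h * cosh (n * a) ^ 2) :
    ∃ (P : Polynomial ℝ) (N : ℝ), P.natDegree ≤ 8 * n + 2 ∧ NB P (4 * 7 ^ (4 * n)) ∧
      2 * h * cosh (n * a) ^ 2 ≤ N ∧ ∀ v : ℝ, 0 ≤ P.eval v ∧ (2 * h ≤ v → 1 ≤ P.eval v) ∧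
        (|v| ≤ 1 → P.eval v ≤ (if -(2 * h) ≤ v then 1 else 0) + 4 / N) ∧
        (1 ≤ |v| → P.eval v ≤ 9 * (2 * v ^ 2) ^ (4 * n + 2)) := by
  have hpos : 0 < h := by rw [hh]; exact sinh_pos_iff.2 (by linarith)
  have hcosh : cosh a = 1 + 2 * h ^ 2 := by
    have h1 := cosh_two_mul (a / 2)
    have h2 := cosh_sq (a / 2)
    rw [show 2 * (a / 2) = a by ring] at h1
    rw [h1, h2, hh]; ring
  have hsq : h ^ 2 ≤ 1 / 64 := by nlinarith
  set q : Polynomial ℝ := Polynomial.C (1 + 4 * h ^ 2) - Polynomial.X ^ 2 with hq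
  have hqe : ∀ v, q.eval v = 1 + 4 * h ^ 2 - v ^ 2 := by intro v; simp [hq]
  have hqNB : NB q 3 := by
    refine ((NB_C (1 + 4 * h ^ 2)).sub (NB_X.pow 2)).mono ?_
    rw [abs_of_pos (by positivity)]
    linarith
  have hqd : q.natDegree ≤ 2 := by
    rw [hq]; refine (Polynomial.natDegree_sub_le _ _).trans ?_
    rw [Polynomial.natDegree_C, Polynomial.natDegree_X_pow]; norm_num
  set K : Polynomial ℝ := ((T ℝ n).comp q) ^ 2 with hK
  have hKe : ∀ v, K.eval v = (T ℝ n).eval (1 + 4 * h ^ 2 - v ^ 2) ^ 2 := by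
    intro v; rw [hK, Polynomial.eval_pow, Polynomial.eval_comp, hqe]
  have hK0 : ∀ v, 0 ≤ K.eval v := fun v => by rw [hKe]; positivity
  have hK1 : ∀ v, 2 * h ≤ |v| → |v| ≤ 1 → K.eval v ≤ 1 := by
    intro v h1 h2
    have e1 : (2 * h) ^ 2 ≤ v ^ 2 := by rw [← sq_abs v]; gcongr
    have e2 : v ^ 2 ≤ 1 := by rw [← sq_abs v]; exact pow_le_one₀ (abs_nonneg _) h2
    rw [hKe, ← sq_abs]
    refine pow_le_one₀ (abs_nonneg _) (abs_eval_T_real_le_one _ ?_)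
    rw [abs_le]; constructor <;> nlinarith
  have hKM : ∀ v, -h ≤ v → v ≤ h → cosh (n * a) ^ 2 ≤ K.eval v := by
    intro v h1 h2
    have e1 : v ^ 2 ≤ h ^ 2 := sq_le_sq' h1 h2
    rw [hKe]
    have := T_lower n ha.le (x := 1 + 4 * h ^ 2 - v ^ 2) (by rw [hcosh]; nlinarith)
    have := cosh_pos (n * a)
    gcongr
  have hKup : ∀ v y : ℝ, 1 ≤ |v| → |v| ≤ y → K.eval v ≤ (2 * y ^ 2) ^ (2 * n) := by
    intro v y h1 h2
    have e2 : v ^ 2 ≤ y ^ 2 := by rw [← sq_abs v]; gcongr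
    have e3 : 1 ≤ v ^ 2 := by rw [← sq_abs v]; exact one_le_pow₀ h1
    have e4 : |1 + 4 * h ^ 2 - v ^ 2| ≤ y ^ 2 := by
      rw [abs_le]; constructor <;> nlinarith
    rw [hKe, ← sq_abs, mul_comm 2 n, pow_mul]
    have := T_upper n (e3.trans e2) e4
    gcongr
  have hKd : K.natDegree ≤ 4 * n := by
    rw [hK]
    refine Polynomial.natDegree_pow_le.trans ?_
    have h1 := (Polynomial.natDegree_comp_le (p := T ℝ n) (q := q))
    rw [natDegree_T] at h1
    simp only [Int.natAbs_natCast] at h1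
    nlinarith
  have hKNB : NB K (49 ^ n) := by
    refine ((NB_T_comp hqNB n).pow 2).mono (le_of_eq ?_)
    rw [← pow_mul, mul_comm, pow_mul]; norm_num
  set F := antid K with hF
  have hmono : ∀ x y, x ≤ y → F.eval x ≤ F.eval y := by
    intro x y hxy
    have := le_mvt K hxy (M := 0) (fun v _ _ => hK0 v)
    linarith
  set A : Polynomial ℝ := F - Polynomial.C (F.eval (-1)) with hA
  have hAe : ∀ v, A.eval v = F.eval v - F.eval (-1) := by intro v; simp [hA]
  have hFNB : NB F (49 ^ n) := hKNB.antid
  have hANB : NB A (2 * 49 ^ n) := by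
    refine (hFNB.sub (NB_C _)).mono ?_
    have := hFNB.eval_le (x := -1) (by simp)
    linarith
  have hAd : A.natDegree ≤ 4 * n + 1 := by
    rw [hA, Polynomial.natDegree_sub_C]
    exact (antid_natDegree K).trans (by omega)
  set N := A.eval (2 * h) with hN
  have hNM : 2 * h * cosh (n * a) ^ 2 ≤ N := by
    have h1 := le_mvt K (a := -h) (b := h) (by linarith) (M := cosh (n * a) ^ 2) hKM
    have h2 := hmono (-1) (-h) (by linarith)
    have h3 := hmono h (2 * h) (by linarith)
    rw [hN, hAe]
    linarith
  have hN1 : 1 ≤ N := hM.trans hNM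
  have hA1 : A.eval 1 ≤ N + 1 := by
    have h1 := mvt_le K (a := 2 * h) (b := 1) (by linarith) (M := 1) (fun v h1 h2 =>
      hK1 v (by rw [abs_of_nonneg (by linarith)]; exact h1)
        (by rw [abs_of_nonneg (by linarith)]; exact h2))
    rw [hN, hAe, hAe]
    linarith
  have hAm : A.eval (-(2 * h)) ≤ 1 := by
    have h1 := mvt_le K (a := -1) (b := -(2 * h)) (by linarith) (M := 1) (fun v h1 h2 =>
      hK1 v (by rw [abs_of_nonpos (by linarith)]; linarith)
        (by rw [abs_of_nonpos (by linarith)]; linarith))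
    rw [hAe]
    linarith
  have hAmono : ∀ x y, x ≤ y → A.eval x ≤ A.eval y := by
    intro x y hxy; rw [hAe, hAe]; linarith [hmono x y hxy]
  have hA0 : A.eval (-1) = 0 := by rw [hAe]; ring
  have hPe : ∀ v, ((Polynomial.C (1 / N) * A) ^ 2).eval v = (A.eval v / N) ^ 2 := by
    intro v; simp; ring
  refine ⟨(Polynomial.C (1 / N) * A) ^ 2, N, ?_, ?_, hNM, fun v => ?_⟩
  · refine Polynomial.natDegree_pow_le.trans ?_
    have := Polynomial.natDegree_C_mul_le (1 / N) A
    omega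
  · refine (((NB_C (1 / N)).mul hANB).pow 2).mono ?_
    have h1 : |1 / N| ≤ 1 := by
      rw [abs_of_pos (by positivity), div_le_one (by linarith)]; exact hN1
    calc (|1 / N| * (2 * 49 ^ n)) ^ 2 ≤ (1 * (2 * 49 ^ n)) ^ 2 := by gcongr
      _ = 4 * 7 ^ (4 * n) := by
        rw [pow_mul, one_mul, mul_pow, ← pow_mul, mul_comm n 2, pow_mul]; norm_num
  rw [hPe]
  refine ⟨by positivity, fun hv => ?_, fun hv => ?_, fun hv => ?_⟩
  · refine one_le_pow₀ ?_
    rw [le_div_iff₀ (by linarith), one_mul]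
    exact hAmono _ _ hv
  · rw [abs_le] at hv
    have l0 : 0 ≤ A.eval v := by rw [← hA0]; exact hAmono _ _ hv.1
    have hN0 : 0 < N := by linarith
    have hi1 : 1 / N ≤ 1 := by rw [div_le_one hN0]; exact hN1
    have hi0 : 0 < 1 / N := by positivity
    split_ifs with hc
    · have l1 : A.eval v ≤ N + 1 := (hAmono _ _ hv.2).trans hA1
      have l2 : A.eval v / N ≤ 1 + 1 / N := by
        rw [div_le_iff₀ hN0]; field_simp; exact l1
      have l3 : (A.eval v / N) ^ 2 ≤ (1 + 1 / N) ^ 2 := by gcongr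
      have : 4 / N = 4 * (1 / N) := by ring
      rw [this]; nlinarith
    · have l1 : A.eval v ≤ 1 := (hAmono _ _ (by linarith)).trans hAm
      have l2 : A.eval v / N ≤ 1 / N := by gcongr
      have l3 : (A.eval v / N) ^ 2 ≤ (1 / N) ^ 2 := by gcongr
      have : 4 / N = 4 * (1 / N) := by ring
      rw [this]; nlinarith
  · set w := (2 * v ^ 2) ^ (2 * n) with hw
    have hv2 : 1 ≤ v ^ 2 := by rw [← sq_abs]; exact one_le_pow₀ hv
    have hw1 : 1 ≤ w := one_le_pow₀ (by linarith)
    have key : |A.eval v| ≤ N + 1 + w * |v| := by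
      rw [le_abs'] at hv
      rcases hv with hv | hv
      · have h1 := mvt_le K (a := v) (b := -1) hv (M := w) (fun x h1 h2 => by
          rw [hw, ← sq_abs v]
          exact hKup x |v| (by rw [abs_of_nonpos (by linarith)]; linarith)
            (by rw [abs_of_nonpos (by linarith), abs_of_nonpos (by linarith)]; linarith))
        have h2 := hAmono _ _ hv
        rw [hA0] at h2
        rw [abs_of_nonpos h2, abs_of_nonpos (by linarith), hAe]
        have h3 : w * (-1 - v) = w * -v - w := by ring
        rw [h3] at h1
        linarith
      · have h1 := mvt_le K (a := 1) (b := v) hv (M := w) (fun x h1 h2 => by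
          rw [hw]
          exact hKup x v (by rw [abs_of_nonneg (by linarith)]; linarith) (by rw [abs_of_nonneg (by linarith)]; linarith))
        have h2 := hAmono (-1) v (by linarith)
        rw [hA0] at h2
        rw [abs_of_nonneg h2, abs_of_nonneg (by linarith), hAe]
        rw [hAe] at hA1
        have h3 : w * (v - 1) = w * v - w := by ring
        rw [h3] at h1
        linarith
    have hvv : |v| ≤ 2 * v ^ 2 := by rw [← sq_abs v]; nlinarith
    have hN0 : 0 < N := by linarith
    have k2 : |A.eval v / N| ≤ 3 * (w * (2 * v ^ 2)) := by
      rw [abs_div, abs_of_pos hN0, div_le_iff₀ hN0]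
      have : w * |v| ≤ w * (2 * v ^ 2) := by gcongr
      have h1 : 1 ≤ w * (2 * v ^ 2) := one_le_mul_of_one_le_of_one_le hw1 (by linarith)
      generalize w * (2 * v ^ 2) = W at this h1 ⊢
      have h2 : W ≤ W * N := le_mul_of_one_le_right (by linarith) hN1
      have h3 : N ≤ W * N := le_mul_of_one_le_left (by linarith) h1
      linarith
    calc (A.eval v / N) ^ 2 = |A.eval v / N| ^ 2 := (sq_abs _).symm
      _ ≤ (3 * (w * (2 * v ^ 2))) ^ 2 := by gcongr
      _ = _ := by rw [hw]; ring
end Sandwich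

namespace Sandwich

lemma small_ball (t w : ℝ) (hw : 0 ≤ w) :
    (gaussianReal 0 1).real (Set.Icc (t - w) (t + w)) ≤ 2 * w := by
  have h1 : (gaussianReal 0 1) (Set.Icc (t - w) (t + w)) ≤ ENNReal.ofReal (2 * w) := by
    rw [gaussianReal_apply 0 one_ne_zero]
    calc ∫⁻ x in Set.Icc (t - w) (t + w), gaussianPDF 0 1 x
        ≤ ∫⁻ x in Set.Icc (t - w) (t + w), 1 := by
          refine lintegral_mono fun x => ?_
          rw [gaussianPDF, ENNReal.ofReal_le_one, gaussianPDFReal]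
          have e1 : rexp (-(x - 0) ^ 2 / (2 * ((1 : NNReal) : ℝ))) ≤ 1 := by
            rw [exp_le_one_iff]
            have : 0 ≤ (x - 0) ^ 2 := sq_nonneg _
            push_cast
            linarith
          have e2 : (√(2 * π * ((1 : NNReal) : ℝ)))⁻¹ ≤ 1 := by
            refine inv_le_one_of_one_le₀ ?_
            rw [one_le_sqrt]
            push_cast
            nlinarith [pi_gt_three]
          exact mul_le_one₀ e2 (exp_pos _).le e1
      _ = ENNReal.ofReal (2 * w) := by
          rw [setLIntegral_one, Real.volume_Icc]; congr 1; ring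
  rw [Measure.real]
  exact ENNReal.toReal_le_of_le_ofReal (by linarith) h1

lemma pow_le_exp (D : ℕ) (hD : 1 ≤ D) (z : ℝ) :
    (z ^ 2) ^ D ≤ (2 * D) ^ D * (exp (√(2 * D) * z) + exp (-√(2 * D) * z)) := by
  set l := √(2 * D) with hl
  have hl2 : l ^ 2 = 2 * D := sq_sqrt (by positivity)
  have hD0 : (0:ℝ) < 2 * D := by positivity
  have h1 := pow_div_factorial_le_exp (l * |z|) (by positivity) (2 * D)
  have h2 : exp (l * |z|) ≤ exp (l * z) + exp (-l * z) := by
    rcases abs_cases z with ⟨h, _⟩ | ⟨h, _⟩ <;> rw [h]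
    · linarith [exp_pos (-l * z)]
    · rw [show l * -z = -l * z by ring]; linarith [exp_pos (l * z)]
  have h3 : ((2 * D).factorial : ℝ) ≤ (2 * D) ^ (2 * D) := by
    exact_mod_cast Nat.factorial_le_pow (2 * D)
  rw [div_le_iff₀ (by positivity)] at h1
  have h4 : (l * |z|) ^ (2 * D) = (2 * D) ^ D * (z ^ 2) ^ D := by
    rw [pow_mul, mul_pow, hl2, sq_abs, mul_pow]
  rw [h4] at h1
  have h5 : (2 * D : ℝ) ^ D * (z ^ 2) ^ D ≤
      (2 * D : ℝ) ^ D * ((2 * D) ^ D * (exp (l * z) + exp (-l * z))) := by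
    calc _ ≤ _ := h1
      _ ≤ (exp (l * z) + exp (-l * z)) * (2 * D) ^ (2 * D) := by gcongr
      _ = _ := by rw [two_mul D, pow_add]; ring
  exact le_of_mul_le_mul_left h5 (by positivity)

lemma integral_exp (c : ℝ) : ∫ z, exp (c * z) ∂(gaussianReal 0 1) = exp (c ^ 2 / 2) := by
  have := congrFun (mgf_id_gaussianReal (μ := 0) (v := 1)) c
  simpa [mgf] using this

lemma mid (n : ℕ) (a h L t : ℝ) (ha : 0 < a) (hh : h = sinh (a / 2)) (h8 : h ≤ 1 / 8)
    (hM : 1 ≤ 2 * h * cosh (n * a) ^ 2) (hL : 2 ≤ L) (hL2 : L ^ 2 = 96 * ((4 * n + 2 : ℕ) : ℝ))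
    (ht : |t| ≤ L / 4) :
    ∃ pd pu : Polynomial ℝ,
        pd.natDegree ≤ 8 * n + 2 ∧ pu.natDegree ≤ 8 * n + 2 ∧
        (∀ m, |pd.coeff m| ≤ 5 * 7 ^ (4 * n)) ∧ (∀ m, |pu.coeff m| ≤ 5 * 7 ^ (4 * n)) ∧
        (∀ z : ℝ, pd.eval z ≤ (if z ≤ t then 1 else 0) ∧
          (if z ≤ t then (1:ℝ) else 0) ≤ pu.eval z) ∧
        (∫ z, (pu.eval z - pd.eval z) ∂(gaussianReal 0 1))
          ≤ 8 * h * L + 8 / (2 * h * cosh (n * a) ^ 2) + 36 / 2 ^ (4 * n + 2) := by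
  obtain ⟨P, N, hPd, hPNB, hN, hP⟩ := core n a h ha hh h8 hM
  have hpos : 0 < h := by rw [hh]; exact sinh_pos_iff.2 (by linarith)
  have hL0 : 0 < L := by linarith
  set D := 4 * n + 2 with hD
  have hN0 : 0 < N := by linarith
  have htL : |t / L| ≤ 1 / 4 := by
    rw [abs_div, abs_of_pos hL0, div_le_iff₀ hL0]; linarith
  have htL' := abs_le.1 htL
  set ind : ℝ → ℝ := (Set.Icc (t - 4 * h * L) (t + 4 * h * L)).indicator (fun _ => 1) with hind
  set E : ℝ → ℝ := fun z => exp (√(2 * D) * z) + exp (-√(2 * D) * z) with hE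
  have hE0 : ∀ z, 0 ≤ E z := fun z => by positivity
  have tail : ∀ z b v : ℝ, |b| ≤ 1 / 2 → |v| ≤ |z| / L + |b| → 1 ≤ |v| →
      (2 * v ^ 2) ^ D ≤ (1 / 6) ^ D * E z := by
    intro z b v hb hv h1
    have e1 : |v| ≤ 2 * (|z| / L) := by linarith
    have e2 : v ^ 2 ≤ 4 * (z ^ 2 / L ^ 2) := by
      calc v ^ 2 = |v| ^ 2 := (sq_abs v).symm
        _ ≤ (2 * (|z| / L)) ^ 2 := by gcongr
        _ = _ := by rw [mul_pow, div_pow, sq_abs]; norm_num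
    have hD0 : (0 : ℝ) < D := by positivity
    have e3 : 2 * v ^ 2 ≤ (1 / 6 * (1 / (2 * D))) * z ^ 2 := by
      rw [hL2] at e2
      calc 2 * v ^ 2 ≤ 2 * (4 * (z ^ 2 / (96 * D))) := by linarith
        _ = _ := by field_simp; ring
    calc (2 * v ^ 2) ^ D ≤ ((1 / 6 * (1 / (2 * D))) * z ^ 2) ^ D := by gcongr
      _ = (1 / 6) ^ D * (1 / (2 * D)) ^ D * (z ^ 2) ^ D := by rw [mul_pow, mul_pow]
      _ ≤ (1 / 6) ^ D * (1 / (2 * D)) ^ D * ((2 * D) ^ D * E z) := by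
          gcongr; exact pow_le_exp D (by omega) z
      _ = (1 / 6) ^ D * E z * ((1 / (2 * D)) * (2 * D)) ^ D := by
          rw [mul_pow (1 / (2 * (D : ℝ)))]
          generalize (1 / (2 * (D : ℝ))) ^ D = x
          generalize (2 * (D : ℝ)) ^ D = y
          ring
      _ = _ := by rw [one_div_mul_cancel (by positivity)]; simp
  have Pb : ∀ z b v : ℝ, |b| ≤ 1 / 2 → |v| ≤ |z| / L + |b| →
      P.eval v ≤ (if -(2 * h) ≤ v then 1 else 0) + 4 / N + 9 * ((1 / 6) ^ D * E z) := by
    intro z b v hb hv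
    have p1 : 0 ≤ 4 / N := by positivity
    have p2 : 0 ≤ (1 / 6 : ℝ) ^ D * E z := mul_nonneg (by positivity) (hE0 z)
    have p3 : (0:ℝ) ≤ (if -(2 * h) ≤ v then 1 else 0) := by split_ifs <;> norm_num
    rcases le_total |v| 1 with h1 | h1
    · linarith [(hP v).2.2.1 h1]
    · have := (hP v).2.2.2 h1
      have := tail z b v hb hv h1
      linarith
  set l1 : Polynomial ℝ := Polynomial.C (-(1 / L)) * Polynomial.X + Polynomial.C (2 * h + t / L)
    with hl1
  set l2 : Polynomial ℝ := Polynomial.C (1 / L) * Polynomial.X + Polynomial.C (2 * h - t / L)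
    with hl2
  have l1e : ∀ z, l1.eval z = -(z / L) + (2 * h + t / L) := by intro z; simp [hl1]; ring
  have l2e : ∀ z, l2.eval z = z / L + (2 * h - t / L) := by intro z; simp [hl2]; ring
  have b1 : |2 * h + t / L| ≤ 1 / 2 := by rw [abs_le]; constructor <;> linarith
  have b2 : |2 * h - t / L| ≤ 1 / 2 := by rw [abs_le]; constructor <;> linarith
  have hLi : 1 / L ≤ 1 / 2 := one_div_le_one_div_of_le (by norm_num) hL
  have hLi0 : 0 < 1 / L := by positivity
  have nb1 : NB l1 1 := by
    refine (((NB_C _).mul NB_X).add (NB_C _)).mono ?_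
    rw [abs_neg, abs_of_pos hLi0]; linarith
  have nb2 : NB l2 1 := by
    refine (((NB_C _).mul NB_X).add (NB_C _)).mono ?_
    rw [abs_of_pos hLi0]; linarith
  have d1 : l1.natDegree ≤ 1 := Polynomial.natDegree_linear_le
  have d2 : l2.natDegree ≤ 1 := Polynomial.natDegree_linear_le
  have dd1 : (P.comp l1).natDegree ≤ 8 * n + 2 :=
    Polynomial.natDegree_comp_le.trans (by nlinarith)
  have dd2 : (P.comp l2).natDegree ≤ 8 * n + 2 :=
    Polynomial.natDegree_comp_le.trans (by nlinarith)
  have h7 : (1:ℝ) ≤ 7 ^ (4 * n) := one_le_pow₀ (by norm_num)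
  have sand : ∀ z : ℝ, (1 - P.comp l2).eval z ≤ (if z ≤ t then 1 else 0) ∧
          (if z ≤ t then (1:ℝ) else 0) ≤ (P.comp l1).eval z := by
    intro z
    rw [Polynomial.eval_sub, Polynomial.eval_comp, Polynomial.eval_comp, Polynomial.eval_one,
      l1e, l2e]
    have p1 := (hP (-(z / L) + (2 * h + t / L)))
    have p2 := (hP (z / L + (2 * h - t / L)))
    split_ifs with hz
    · refine ⟨by linarith [p2.1], p1.2.1 ?_⟩
      have : z / L ≤ t / L := by gcongr
      linarith
    · refine ⟨?_, p1.1⟩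
      have : t / L ≤ z / L := by gcongr; linarith
      linarith [p2.2.1 (by linarith)]
  refine ⟨1 - P.comp l2, P.comp l1, ?_, dd1, ?_, ?_, sand, ?_⟩
  · refine (Polynomial.natDegree_sub_le _ _).trans ?_
    simpa using dd2
  · exact ((NB_one.sub (hPNB.comp nb2)).mono (by linarith)).coeff
  · exact ((hPNB.comp nb1).mono (by linarith)).coeff
  have point : ∀ z, (P.comp l1).eval z - (1 - P.comp l2).eval z ≤
      ind z + 8 / N + 18 * (1 / 6) ^ D * E z := by
    intro z
    rw [Polynomial.eval_sub, Polynomial.eval_comp, Polynomial.eval_comp, Polynomial.eval_one]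
    have azL : |z / L| = |z| / L := by rw [abs_div, abs_of_pos hL0]
    have q1 := Pb z (2 * h + t / L) (l1.eval z) b1 (by
      rw [l1e]; refine (abs_add_le _ _).trans (le_of_eq ?_); rw [abs_neg, azL])
    have q2 := Pb z (2 * h - t / L) (l2.eval z) b2 (by
      rw [l2e]; refine (abs_add_le _ _).trans (le_of_eq ?_); rw [azL])
    have q3 : (if -(2 * h) ≤ l1.eval z then (1:ℝ) else 0) + (if -(2 * h) ≤ l2.eval z then 1 else 0)
        - 1 ≤ ind z := by
      by_cases hz : z ∈ Set.Icc (t - 4 * h * L) (t + 4 * h * L)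
      · rw [hind, Set.indicator_of_mem hz]
        split_ifs <;> norm_num
      · rw [hind, Set.indicator_of_notMem hz]
        have : ¬ (-(2 * h) ≤ l1.eval z ∧ -(2 * h) ≤ l2.eval z) := by
          rintro ⟨r1, r2⟩
          apply hz
          rw [l1e] at r1
          rw [l2e] at r2
          have hzz : z / L * L = z := div_mul_cancel₀ _ hL0.ne'
          have htt : t / L * L = t := div_mul_cancel₀ _ hL0.ne'
          have r1 := mul_le_mul_of_nonneg_right r1 hL0.le
          have r2 := mul_le_mul_of_nonneg_right r2 hL0.le
          constructor <;> linarith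
        by_cases g1 : -(2 * h) ≤ l1.eval z
        · have g2 : ¬ -(2 * h) ≤ l2.eval z := fun g2 => this ⟨g1, g2⟩
          rw [if_pos g1, if_neg g2]; norm_num
        · rw [if_neg g1]
          split_ifs <;> norm_num
    have e : 8 / N = 4 / N + 4 / N := by ring
    rw [e]
    linarith
  have hEi : Integrable E (gaussianReal 0 1) :=
    (integrable_exp_mul_gaussianReal _).add (integrable_exp_mul_gaussianReal _)
  have hindi : Integrable ind (gaussianReal 0 1) :=
    (integrable_const (1:ℝ)).indicator measurableSet_Icc
  have hE1 : ∫ z, E z ∂(gaussianReal 0 1) = 2 * exp 1 ^ D := by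
    rw [hE, integral_add (integrable_exp_mul_gaussianReal _) (integrable_exp_mul_gaussianReal _),
      integral_exp, integral_exp, neg_sq, sq_sqrt (by positivity), ← exp_nat_mul]
    ring_nf
  have hind1 : ∫ z, ind z ∂(gaussianReal 0 1) ≤ 2 * (4 * h * L) := by
    rw [hind, integral_indicator_const _ measurableSet_Icc, smul_eq_mul, mul_one]
    exact small_ball t _ (by positivity)
  calc ∫ z, ((P.comp l1).eval z - (1 - P.comp l2).eval z) ∂(gaussianReal 0 1)
      ≤ ∫ z, (ind z + 8 / N + 18 * (1 / 6) ^ D * E z) ∂(gaussianReal 0 1) := by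
        refine integral_mono_of_nonneg (Filter.Eventually.of_forall fun z => ?_)
          ((hindi.add (integrable_const _)).add (hEi.const_mul _))
          (Filter.Eventually.of_forall point)
        have := sand z
        simp only [Pi.zero_apply]
        linarith
    _ = ∫ z, ind z ∂(gaussianReal 0 1) + 8 / N + 18 * (1 / 6) ^ D * (2 * exp 1 ^ D) := by
        rw [integral_add (f := fun z => ind z + 8 / N) (hindi.add (integrable_const _))
            (hEi.const_mul _),
          integral_add hindi (integrable_const _), integral_const_mul, hE1]
        simp
    _ ≤ 8 * h * L + 8 / (2 * h * cosh (n * a) ^ 2) + 36 / 2 ^ D := by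
        have s1 : 8 / N ≤ 8 / (2 * h * cosh (n * a) ^ 2) := by gcongr
        have s2 : 18 * (1 / 6) ^ D * (2 * exp 1 ^ D) ≤ 36 / 2 ^ D := by
          have : 18 * (1 / 6) ^ D * (2 * exp 1 ^ D) = 36 * (1 / 6 * exp 1) ^ D := by
            rw [mul_pow]; ring
          rw [this, div_eq_mul_inv 36, ← inv_pow]
          have := exp_one_lt_d9
          gcongr
          linarith
        linarith

end Sandwich

namespace Sandwich

lemma integral_sq : ∫ z, z ^ 2 ∂(gaussianReal 0 1) = 1 := by
  have h := variance_fun_id_gaussianReal (μ := 0) (v := 1)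
  rw [variance_of_integral_eq_zero (by fun_prop) (by simp)] at h
  simpa using h

lemma simple (t : ℝ) (ht : 1 ≤ |t|) (k : ℕ) (hk : 2 ≤ k) :
    ∃ pd pu : Polynomial ℝ,
        pd.natDegree ≤ k ∧ pu.natDegree ≤ k ∧
        (∀ n, |pd.coeff n| ≤ 2 ^ (10 * k)) ∧ (∀ n, |pu.coeff n| ≤ 2 ^ (10 * k)) ∧
        (∀ z : ℝ, pd.eval z ≤ (if z ≤ t then 1 else 0) ∧
          (if z ≤ t then (1:ℝ) else 0) ≤ pu.eval z) ∧
        (∫ z, (pu.eval z - pd.eval z) ∂(gaussianReal 0 1)) = 1 / t ^ 2 := by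
  set r : Polynomial ℝ := Polynomial.C (1 / t ^ 2) * Polynomial.X ^ 2 with hr
  have ht2 : 1 ≤ t ^ 2 := by rw [← sq_abs]; exact one_le_pow₀ ht
  have hre : ∀ z, r.eval z = 1 / t ^ 2 * z ^ 2 := by intro z; simp [hr]
  have hrd : r.natDegree ≤ 2 := Polynomial.natDegree_C_mul_X_pow_le _ _
  have hrNB : NB r 1 := by
    refine ((NB_C _).mul (NB_X.pow 2)).mono ?_
    rw [abs_of_pos (by positivity), one_pow, mul_one, div_le_one (by linarith)]
    exact ht2
  have hint : ∫ z, r.eval z ∂(gaussianReal 0 1) = 1 / t ^ 2 := by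
    simp_rw [hre]; rw [integral_const_mul, integral_sq, mul_one]
  have hr0 : ∀ z, 0 ≤ r.eval z := fun z => by rw [hre]; positivity
  have hr1 : ∀ z, t ^ 2 ≤ z ^ 2 → 1 ≤ r.eval z := by
    intro z hz
    rw [hre, one_div, inv_mul_eq_div, le_div_iff₀ (by linarith)]; linarith
  have big : (2:ℝ) ≤ 2 ^ (10 * k) := by
    calc (2:ℝ) = 2 ^ 1 := by norm_num
      _ ≤ _ := pow_le_pow_right₀ (by norm_num) (by omega)
  rw [le_abs'] at ht
  rcases ht with ht | ht
  · refine ⟨0, r, by simp, by omega, ?_, (hrNB.mono (by linarith)).coeff, fun z => ?_, by simpa using hint⟩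
    · intro n; simp
    · split_ifs with hz
      · exact ⟨by simp, hr1 z (by nlinarith)⟩
      · exact ⟨by simp, hr0 z⟩
  · refine ⟨1 - r, 1, ?_, by simp, ((NB_one.sub hrNB).mono (by linarith)).coeff,
      (NB_one.mono (by linarith)).coeff, fun z => ?_, by simpa using hint⟩
    · exact (Polynomial.natDegree_sub_le _ _).trans (by simp; omega)
    · rw [Polynomial.eval_sub, Polynomial.eval_one]
      split_ifs with hz
      · exact ⟨by linarith [hr0 z], le_rfl⟩
      · exact ⟨by linarith [hr1 z (by nlinarith)], by norm_num⟩

set_option maxHeartbeats 2000000 in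
lemma main_case (k : ℕ) (hk : 1000000 ≤ k) (t : ℝ) (ht : t ^ 2 ≤ k) :
    ∃ pd pu : Polynomial ℝ,
        pd.natDegree ≤ k ∧ pu.natDegree ≤ k ∧
        (∀ n, |pd.coeff n| ≤ 2 ^ (10 * k)) ∧ (∀ n, |pu.coeff n| ≤ 2 ^ (10 * k)) ∧
        (∀ z : ℝ, pd.eval z ≤ (if z ≤ t then 1 else 0) ∧
          (if z ≤ t then (1:ℝ) else 0) ≤ pu.eval z) ∧
        (∫ z, (pu.eval z - pd.eval z) ∂(gaussianReal 0 1))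
          ≤ 1300 * Real.log ((k : ℝ) + 2) / √k := by
  obtain ⟨n, hn⟩ : ∃ n, n = k / 10 := ⟨_, rfl⟩
  have hn1 : 10 * n ≤ k := by omega
  have hn2 : k ≤ 20 * n := by omega
  have hkR : (1000000 : ℝ) ≤ k := by exact_mod_cast hk
  have hn1R : 10 * (n : ℝ) ≤ k := by exact_mod_cast hn1
  have hn2R : (k : ℝ) ≤ 20 * n := by exact_mod_cast hn2
  have hn0 : (0 : ℝ) < n := by linarith
  set l := Real.log ((k : ℝ) + 2) with hl
  have hl1 : 1 ≤ l := by
    rw [hl, le_log_iff_exp_le (by linarith)]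
    linarith [exp_one_lt_d9]
  have hlexp : exp l = k + 2 := exp_log (by linarith)
  set s := √(k : ℝ) with hs
  have hs2 : s ^ 2 = k := sq_sqrt (by linarith)
  have hs0 : 1000 ≤ s := by rw [hs]; exact le_sqrt_of_sq_le (by linarith)
  have hls : l ≤ 2 * (s + 1) := by
    have h1 : (k : ℝ) + 2 ≤ (s + 1) ^ 2 := by nlinarith
    have h2 : l ≤ Real.log ((s + 1) ^ 2) := log_le_log (by linarith) h1
    rw [log_pow] at h2
    have h3 := log_le_sub_one_of_pos (show 0 < s + 1 by linarith)
    push_cast at h2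
    linarith
  set a := l / n with ha
  have ha0 : 0 < a := by positivity
  have hna : n * a = l := by rw [ha]; field_simp
  have ha8 : a ≤ 1 / 8 := by
    rw [ha, div_le_iff₀ hn0]; nlinarith
  obtain ⟨h, hh⟩ : ∃ h, h = sinh (a / 2) := ⟨_, rfl⟩
  have hha : h ≤ a := by
    have e1 := abs_le.1 (abs_exp_sub_one_sub_id_le (x := a / 2) (by rw [abs_of_pos] <;> linarith))
    have e2 := add_one_le_exp (-(a / 2))
    rw [hh, sinh_eq]
    nlinarith
  have hah : a / 2 ≤ h := by rw [hh]; exact self_le_sinh_iff.2 (by linarith)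
  have hc : ((k:ℝ) + 2) / 2 ≤ cosh (n * a) := by
    rw [hna, cosh_eq, hlexp]; linarith [exp_pos (-l)]
  have hM : (k : ℝ) ≤ 2 * h * cosh (n * a) ^ 2 := by
    calc (k : ℝ) ≤ a * (((k:ℝ) + 2) / 2) ^ 2 := by
          rw [ha, div_mul_eq_mul_div, le_div_iff₀ hn0]
          nlinarith
      _ ≤ 2 * h * cosh (n * a) ^ 2 := by
          have : a ≤ 2 * h := by linarith
          have : 0 ≤ 2 * h := by linarith
          gcongr
  obtain ⟨L, hLd⟩ : ∃ L, L = √(96 * ((4 * n + 2 : ℕ) : ℝ)) := ⟨_, rfl⟩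
  have hL2 : L ^ 2 = 96 * ((4 * n + 2 : ℕ) : ℝ) := by rw [hLd]; exact sq_sqrt (by positivity)
  have hL0 : 0 ≤ L := by rw [hLd]; exact sqrt_nonneg _
  have hL2' : L ^ 2 = 96 * (4 * n + 2) := by rw [hL2]; push_cast; ring
  have hL : 2 ≤ L := by nlinarith
  have htL : |t| ≤ L / 4 := by
    refine abs_le_of_sq_le_sq ?_ (by linarith)
    nlinarith
  have hLs : L ≤ 8 * s := by
    refine le_of_sq_le_sq ?_ (by linarith)
    nlinarith
  obtain ⟨pd, pu, g1, g2, g3, g4, g5, g6⟩ := mid n a h L t ha0 hh (hha.trans ha8)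
    (by linarith) hL hL2 htL
  have hcoef : (5:ℝ) * 7 ^ (4 * n) ≤ 2 ^ (10 * k) := by
    calc (5:ℝ) * 7 ^ (4 * n) ≤ 2 ^ 3 * (2 ^ 3) ^ (4 * n) := by gcongr <;> norm_num
      _ = 2 ^ (3 + 3 * (4 * n)) := by rw [← pow_mul, ← pow_add]
      _ ≤ _ := pow_le_pow_right₀ (by norm_num) (by omega)
  refine ⟨pd, pu, by omega, by omega, fun m => (g3 m).trans hcoef, fun m => (g4 m).trans hcoef,
    g5, g6.trans ?_⟩
  have hspos : 0 < s := by linarith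
  have r1 : 8 * h * L ≤ 1280 * l / s := by
    rw [le_div_iff₀ hspos]
    calc 8 * h * L * s ≤ 8 * a * (8 * s) * s := by gcongr
      _ = 64 * a * k := by rw [← hs2]; ring
      _ ≤ 64 * a * (20 * n) := by gcongr
      _ = 1280 * l := by rw [← hna]; ring
      _ ≤ _ := by linarith
  have r2 : 8 / (2 * h * cosh (n * a) ^ 2) ≤ l / s := by
    have e1 : 8 / (2 * h * cosh (n * a) ^ 2) ≤ 8 / (k : ℝ) := by gcongr
    refine e1.trans ?_
    rw [div_le_div_iff₀ (by linarith) hspos, ← hs2]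
    nlinarith
  have r3 : (36:ℝ) / 2 ^ (4 * n + 2) ≤ l / s := by
    have e0 : ((4 * n + 2 : ℕ) : ℝ) ≤ 2 ^ (4 * n + 2) := by
      exact_mod_cast (Nat.lt_two_pow_self (n := 4 * n + 2)).le
    push_cast at e0
    have e1 : (36:ℝ) / 2 ^ (4 * n + 2) ≤ 36 / ((k : ℝ) / 5) := by
      gcongr
      linarith
    refine e1.trans ?_
    rw [div_le_div_iff₀ (by linarith) hspos, ← hs2]
    nlinarith
  have : 1300 * l / s = 1280 * l / s + 20 * (l / s) := by ring
  have : 0 < l / s := by positivity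
  linarith

end Sandwich

/-- `L1` sandwiching polynomials for one-dimensional half-line indicators under `N(0,1)`:
for every `k ≥ 2` and `t ∈ ℝ` there are degree-`≤ k` polynomials `p_down ≤ 1_{z ≤ t} ≤ p_up`
with coefficients bounded by `2^{10k}` and `E_{N(0,1)}[p_up - p_down] ≤ C·(log(k+2))³/√k`;
moreover, if `|t| ≥ 1` they can be chosen with `E_{N(0,1)}[p_up - p_down] ≤ C/t²` as well. -/
theorem one_dim_sandwiching_L1 :
    ∃ C : ℝ, 1 ≤ C ∧
      ∀ k : ℕ, 2 ≤ k → ∀ t : ℝ,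
      ∃ pd pu : Polynomial ℝ,
        pd.natDegree ≤ k ∧ pu.natDegree ≤ k ∧
        (∀ n, |pd.coeff n| ≤ 2 ^ (10 * k)) ∧ (∀ n, |pu.coeff n| ≤ 2 ^ (10 * k)) ∧
        (∀ z : ℝ, pd.eval z ≤ (if z ≤ t then 1 else 0) ∧
          (if z ≤ t then (1:ℝ) else 0) ≤ pu.eval z) ∧
        (∫ z, (pu.eval z - pd.eval z) ∂(gaussianReal 0 1))
          ≤ C * (Real.log ((k : ℝ) + 2)) ^ 3 / Real.sqrt k ∧
        (1 ≤ |t| →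
          (∫ z, (pu.eval z - pd.eval z) ∂(gaussianReal 0 1)) ≤ C / t ^ 2) := by
  refine ⟨1300, by norm_num, fun k hk t => ?_⟩
  have hkR : (2 : ℝ) ≤ k := by exact_mod_cast hk
  have hl1 : 1 ≤ Real.log ((k : ℝ) + 2) := by
    rw [le_log_iff_exp_le (by linarith)]
    linarith [exp_one_lt_d9]
  obtain ⟨l, hl⟩ : ∃ l, l = Real.log ((k : ℝ) + 2) := ⟨_, rfl⟩
  rw [← hl] at hl1 ⊢
  have hs0 : 0 < Real.sqrt k := sqrt_pos.2 (by linarith)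
  have hl3 : l ≤ l ^ 3 := le_self_pow₀ hl1 (by norm_num)
  by_cases hT : 1 ≤ |t|
  · have ht2 : 1 ≤ t ^ 2 := by rw [← sq_abs]; exact one_le_pow₀ hT
    by_cases hc : k < 1000000 ∨ Real.sqrt k / l ≤ t ^ 2
    · obtain ⟨pd, pu, g1, g2, g3, g4, g5, g6⟩ := Sandwich.simple t hT k hk
      refine ⟨pd, pu, g1, g2, g3, g4, g5, ?_, fun _ => ?_⟩
      · rw [g6, div_le_div_iff₀ (by linarith) hs0, one_mul]
        rcases hc with hc | hc
        · have h1 : Real.sqrt k ≤ 1000 := by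
            rw [sqrt_le_left (by norm_num)]
            have : (k : ℝ) < 1000000 := by exact_mod_cast hc
            linarith
          nlinarith
        · rw [div_le_iff₀ (by linarith)] at hc
          nlinarith
      · rw [g6]; gcongr; norm_num
    · push Not at hc
      obtain ⟨hk6, hc⟩ := hc
      have hc' := hc
      rw [lt_div_iff₀ (by linarith)] at hc
      have hsk : Real.sqrt k ≤ k := by
        rw [sqrt_le_left (by linarith)]; nlinarith
      obtain ⟨pd, pu, g1, g2, g3, g4, g5, g6⟩ := Sandwich.main_case k hk6 t (by nlinarith)
      rw [← hl] at g6
      refine ⟨pd, pu, g1, g2, g3, g4, g5, ?_, fun _ => ?_⟩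
      · refine g6.trans ?_
        gcongr
      · refine g6.trans ?_
        rw [div_le_div_iff₀ hs0 (by linarith)]
        nlinarith
  · have hT' := not_le.1 hT
    have ht2 : t ^ 2 ≤ 1 := by rw [← sq_abs]; exact pow_le_one₀ (abs_nonneg _) hT'.le
    by_cases hc : k < 1000000
    · refine ⟨0, 1, by simp, by simp, by simp, (Sandwich.NB_one.mono ?_).coeff, fun z => ?_, ?_,
        fun h => absurd h hT⟩
      · exact one_le_pow₀ (by norm_num)
      · split_ifs <;> simp
      · have h1 : Real.sqrt k ≤ 1000 := by
          rw [sqrt_le_left (by norm_num)]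
          have : (k : ℝ) < 1000000 := by exact_mod_cast hc
          linarith
        simp only [Polynomial.eval_one, Polynomial.eval_zero, sub_zero, integral_const,
          probReal_univ, smul_eq_mul, mul_one]
        rw [le_div_iff₀ hs0]
        nlinarith
    · obtain ⟨pd, pu, g1, g2, g3, g4, g5, g6⟩ := Sandwich.main_case k (by omega) t (by linarith)
      rw [← hl] at g6
      refine ⟨pd, pu, g1, g2, g3, g4, g5, g6.trans ?_, fun h => absurd h hT⟩
      gcongr

end
end
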